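/- arXiv:1609.08826 — 2 statements merged into one kernel-verified Lean document; each statement's English description precedes it below -/
import Mathlib

section
/- Let h, m be integers and k a positive integer with gcd(h,k) = 1. Then |S(h,m;k)| ≤ d(k) · k^{1/2}, where S(h,m;k) = ∑_{x ∈ (ℤ/kℤ)^×} e((hx + m x̄)/k) is the Kloosterman sum and d(k) is the number of divisors of k. -/
open Real Complex

/-- The Kloosterman sum `S(h, m; k)`, for `k` a positive integer. -/
noncomputable def kloosterman (h m : ℤ) (k : ℕ) [NeZero k] : ℂ :=
  ∑ x : (ZMod k)ˣ,
    Complex.exp (2 * Real.pi * Complex.I *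
      ((h * ((x : ZMod k).val : ℤ) + m * (((x⁻¹ : (ZMod k)ˣ) : ZMod k).val : ℤ)) / (k : ℂ)))

section Stepanov

open Polynomial

theorem eq_zero_of_sq_mul_squarefree {K : Type*} [Field K] {D : K[X]} (hD : Squarefree D)
    (hdeg : 0 < D.natDegree) {κ : K} (hκ : κ ≠ 0) {v w : K[X]} (h : v ^ 2 * D = C κ * w ^ 2) :
    v = 0 ∧ w = 0 := by
  have hD0 : D ≠ 0 := hD.ne_zero
  have hv : v = 0 := by
    induction hn : v.natDegree using Nat.strong_induction_on generalizing v w with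
    | _ n ih =>
      have h1 : D ∣ w := by
        rw [← hD.dvd_pow_iff_dvd two_ne_zero]
        have : D ∣ C κ * w ^ 2 := h ▸ dvd_mul_left _ _
        exact (IsUnit.dvd_mul_left (isUnit_C.2 hκ.isUnit)).1 this
      obtain ⟨w', rfl⟩ := h1
      have h2 : v ^ 2 = C κ * D * w' ^ 2 := by
        apply mul_right_cancel₀ hD0
        rw [h]; ring
      have h3 : D ∣ v := by
        rw [← hD.dvd_pow_iff_dvd two_ne_zero, h2]
        exact ⟨C κ * w' ^ 2, by ring⟩
      obtain ⟨v', rfl⟩ := h3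
      have h4 : v' ^ 2 * D = C κ * w' ^ 2 := by
        apply mul_left_cancel₀ hD0
        linear_combination h2
      by_contra hne
      have hv' : v' ≠ 0 := right_ne_zero_of_mul hne
      refine hv' (ih v'.natDegree ?_ h4 rfl)
      rw [← hn, natDegree_mul hD0 hv']
      omega
  refine ⟨hv, ?_⟩
  subst hv
  have : C κ * w ^ 2 = 0 := by rw [← h]; ring
  simpa [hκ] using this

theorem exists_sum_mul_X_pow_eq {K : Type*} [Field K] (v : ℕ → K[X]) (Q : ℕ) {i₀ l : ℕ}
    (hl : i₀ < l) (hv : ∀ i < i₀, v i = 0) :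
    ∃ W, ∑ i ∈ Finset.range l, v i * X ^ (i * Q) = X ^ (i₀ * Q) * (v i₀ + X ^ Q * W) := by
  refine ⟨∑ i ∈ Finset.Ico (i₀ + 1) l, v i * X ^ ((i - (i₀ + 1)) * Q), ?_⟩
  rw [Finset.range_eq_Ico, ← Finset.sum_Ico_consecutive _ (Nat.zero_le i₀) hl.le,
    Finset.sum_eq_zero (s := Finset.Ico 0 i₀), zero_add, Finset.sum_eq_sum_Ico_succ_bot hl,
    mul_add, ← mul_assoc, Finset.mul_sum]
  · congr 1
    · ring
    · refine Finset.sum_congr rfl fun i hi => ?_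
      obtain ⟨k, rfl⟩ := Nat.exists_eq_add_of_le (Finset.mem_Ico.1 hi).1
      rw [Nat.add_sub_cancel_left]
      ring
  · intro i hi
    rw [hv i (Finset.mem_Ico.1 hi).2, zero_mul]

theorem eq_zero_of_sum_add_pow_mul_sum_eq_zero {K : Type*} [Field K] {p : ℕ} [Fact p.Prime]
    [CharP K p] {s e l m Q : ℕ} (hQ : Q = p ^ s) (he : 2 * e + 1 = Q) {D : K[X]}
    (hD : Squarefree D) (hdeg : 0 < D.natDegree) (hD0 : D.coeff 0 ≠ 0)
    (hm : 2 * m + D.natDegree < Q) {v w : ℕ → K[X]} (hv : ∀ i, (v i).natDegree ≤ m)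
    (hw : ∀ i, (w i).natDegree ≤ m)
    (h : ∑ i ∈ Finset.range l, v i * X ^ (i * Q) +
      D ^ e * ∑ i ∈ Finset.range l, w i * X ^ (i * Q) = 0) (i : ℕ) (hi : i < l) :
    v i = 0 ∧ w i = 0 := by
  induction i using Nat.strong_induction_on with
  | _ i ih =>
    obtain ⟨V, hV⟩ := exists_sum_mul_X_pow_eq v Q hi fun j hj => (ih j hj (hj.trans hi)).1
    obtain ⟨W, hW⟩ := exists_sum_mul_X_pow_eq w Q hi fun j hj => (ih j hj (hj.trans hi)).2
    rw [hV, hW] at h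
    have h1 : v i + X ^ Q * V = -(D ^ e * (w i + X ^ Q * W)) := by
      apply mul_left_cancel₀ (pow_ne_zero (i * Q) (X_ne_zero (R := K)))
      linear_combination h
    have hDQ : D ^ Q = C (D.coeff 0 ^ Q) + X ^ Q * D.divX ^ Q := by
      subst hQ
      conv_lhs => rw [← D.divX_mul_X_add]
      rw [add_pow_char_pow, mul_pow, C_pow]
      ring
    have h2 : (v i + X ^ Q * V) ^ 2 * D =
        (C (D.coeff 0 ^ Q) + X ^ Q * D.divX ^ Q) * (w i + X ^ Q * W) ^ 2 := by
      rw [← hDQ, h1, ← he]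
      ring
    have h3 : X ^ Q ∣ v i ^ 2 * D - C (D.coeff 0 ^ Q) * w i ^ 2 := by
      refine ⟨D.divX ^ Q * (w i + X ^ Q * W) ^ 2 + C (D.coeff 0 ^ Q) * (2 * w i * W + X ^ Q * W ^ 2)
        - (2 * v i * V + X ^ Q * V ^ 2) * D, ?_⟩
      linear_combination h2
    have h4 : v i ^ 2 * D - C (D.coeff 0 ^ Q) * w i ^ 2 = 0 := by
      refine eq_zero_of_dvd_of_natDegree_lt h3 ?_
      rw [natDegree_X_pow]
      refine (natDegree_sub_le_of_le (m := Q - 1) (n := Q - 1) ?_ ?_).trans_lt ?_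
      · refine (natDegree_mul_le.trans (Nat.add_le_add_right natDegree_pow_le _)).trans ?_
        have := hv i
        omega
      · refine (natDegree_C_mul_le _ _).trans (natDegree_pow_le.trans ?_)
        have := hw i
        omega
      · rw [max_self]; omega
    exact eq_zero_of_sq_mul_squarefree hD hdeg (pow_ne_zero Q hD0) (sub_eq_zero.1 h4)

theorem exists_nontrivial_relation_of_degree_lt {K : Type*} [Field K] {l m E : ℕ}
    (w w' : ℕ → ℕ → K[X]) (hw : ∀ i < l, ∀ j < m, (w i j).degree < E)
    (hw' : ∀ i < l, ∀ j < m, (w' i j).degree < E) (hE : E < 2 * (l * m)) :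
    ∃ c c' : ℕ → ℕ → K, (∃ i < l, ∃ j < m, c i j ≠ 0 ∨ c' i j ≠ 0) ∧
      ∑ i ∈ Finset.range l, ∑ j ∈ Finset.range m, c i j • w i j +
      ∑ i ∈ Finset.range l, ∑ j ∈ Finset.range m, c' i j • w' i j = 0 := by
  let u : (Fin l × Fin m) ⊕ (Fin l × Fin m) → degreeLT K E :=
    Sum.elim (fun a => ⟨w a.1 a.2, mem_degreeLT.2 (hw _ a.1.2 _ a.2.2)⟩)
      (fun a => ⟨w' a.1 a.2, mem_degreeLT.2 (hw' _ a.1.2 _ a.2.2)⟩)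
  have hfin : Module.finrank K (degreeLT K E) = E := by
    rw [LinearEquiv.finrank_eq (degreeLTEquiv K E), Module.finrank_fin_fun]
  have : Module.Finite K (degreeLT K E) := Module.Finite.equiv (degreeLTEquiv K E).symm
  have hu : ¬ LinearIndependent K u := by
    intro hli
    have := hli.fintype_card_le_finrank
    simp only [Fintype.card_sum, Fintype.card_prod, Fintype.card_fin, hfin] at this
    omega
  obtain ⟨g, hg, a, ha⟩ := Fintype.not_linearIndependent_iff.1 hu
  refine ⟨fun i j => if h : i < l ∧ j < m then g (Sum.inl (⟨i, h.1⟩, ⟨j, h.2⟩)) else 0,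
    fun i j => if h : i < l ∧ j < m then g (Sum.inr (⟨i, h.1⟩, ⟨j, h.2⟩)) else 0, ?_, ?_⟩
  · rcases a with ⟨i, j⟩ | ⟨i, j⟩
    · exact ⟨i, i.2, j, j.2, Or.inl (by simpa using ha)⟩
    · exact ⟨i, i.2, j, j.2, Or.inr (by simpa using ha)⟩
  · have := congrArg (Submodule.subtype _) hg
    simp only [Fintype.sum_sum_type, Fintype.sum_prod_type, map_add, map_sum, map_smul, map_zero,
      u, Sum.elim_inl, Sum.elim_inr, Submodule.subtype_apply] at this
    rw [← this]
    simp only [Finset.sum_range]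
    simp

end Stepanov

section Stepanov

open Polynomial

theorem two_mul_card_pow_eq_le {K : Type*} [Field K] [Fintype K] [DecidableEq K] {p : ℕ}
    [Fact p.Prime] [CharP K p] {s e m Q : ℕ} (hQ : Q = p ^ s) (he : 2 * e + 1 = Q)
    (hcard : Fintype.card K = Q ^ 2) {D : K[X]} (hD : Squarefree D) (hdeg : 0 < D.natDegree)
    (hD0 : D.coeff 0 ≠ 0) (hem : e = D.natDegree + m) (hm : D.natDegree ≤ m) {ε : K}
    (hε : ε ≠ 0) :
    2 * (Finset.univ.filter fun y : K => D.eval y ^ (e * (Q + 1)) = ε).card ≤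
      Q ^ 2 + (3 * D.natDegree + 2) * Q := by
  set d := D.natDegree with hd
  set l := e + d + 2 with hl
  have hDne : D ≠ 0 := hD.ne_zero
  have hQpos : 0 < Q := by omega
  obtain ⟨c, c', hne, hrel⟩ := exists_nontrivial_relation_of_degree_lt (K := K) (l := l)
    (m := m + 1) (E := d * e + m * Q + l) (fun i j => D ^ e * X ^ (j * Q + i))
    (fun i j => C ε * X ^ (j * Q + i)) (by
      intro i hi j hj
      rw [← natDegree_lt_iff_degree_lt (mul_ne_zero (pow_ne_zero _ hDne) (by simp)),
        natDegree_mul (pow_ne_zero _ hDne) (by simp), natDegree_pow, natDegree_X_pow]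
      have : j * Q ≤ m * Q := Nat.mul_le_mul_right _ (by omega)
      rw [← hd, mul_comm e d]
      omega) (by
      intro i hi j hj
      rw [← natDegree_lt_iff_degree_lt (mul_ne_zero (by simpa using hε) (by simp)),
        natDegree_C_mul hε, natDegree_X_pow]
      have : j * Q ≤ m * Q := Nat.mul_le_mul_right _ (by omega)
      omega) (by
      subst hem
      rw [hl, ← he]
      nlinarith)
  let v : ℕ → K[X] := fun i => ∑ j ∈ Finset.range (m + 1), C (c i j ^ Q) * X ^ j
  let w : ℕ → K[X] := fun i => ∑ j ∈ Finset.range (m + 1), C (c' i j ^ Q) * X ^ j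
  let G : K[X] := ∑ i ∈ Finset.range l, v i * X ^ (i * Q) +
      D ^ e * ∑ i ∈ Finset.range l, w i * X ^ (i * Q)
  have hdegsum : ∀ a : ℕ → K,
      (∑ j ∈ Finset.range (m + 1), C (a j) * X ^ j).natDegree ≤ m := fun a =>
    natDegree_sum_le_of_forall_le _ _ fun j hj =>
      (natDegree_C_mul_X_pow_le _ _).trans (by simpa [Nat.lt_succ_iff] using hj)
  have hcoeff : ∀ (a : ℕ → K), (∑ j ∈ Finset.range (m + 1), C (a j ^ Q) * X ^ j = 0) →
      ∀ j < m + 1, a j = 0 := by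
    intro a ha j hj
    have := congrArg (fun f => f.coeff j) ha
    simp only [finsetSum_coeff, coeff_C_mul, coeff_X_pow, coeff_zero] at this
    rw [Finset.sum_eq_single j] at this
    · simpa [hQpos.ne'] using this
    · intro b _ hb; simp [hb.symm]
    · intro hb; simp [hj] at hb
  have hG : G ≠ 0 := by
    intro hG0
    obtain ⟨i, hi, j, hj, hij⟩ := hne
    have := eq_zero_of_sum_add_pow_mul_sum_eq_zero hQ he hD hdeg hD0 (m := m)
      (by omega) (fun i => hdegsum _) (fun i => hdegsum _) hG0 i hi
    exact hij.elim (fun h => h (hcoeff _ this.1 j hj)) (fun h => h (hcoeff _ this.2 j hj))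
  have hdegG : G.natDegree ≤ e * d + m + (l - 1) * Q := by
    have key : ∀ u : ℕ → K[X], (∀ i, (u i).natDegree ≤ m) →
        (∑ i ∈ Finset.range l, u i * X ^ (i * Q)).natDegree ≤ m + (l - 1) * Q := by
      intro u hu
      refine natDegree_sum_le_of_forall_le _ _ fun i hi => natDegree_mul_le.trans ?_
      rw [natDegree_X_pow]
      have hi' := Finset.mem_range.1 hi
      have : i * Q ≤ (l - 1) * Q := Nat.mul_le_mul_right _ (by omega)
      have := hu i
      omega
    refine natDegree_add_le_of_degree_le ((key v fun i => hdegsum _).trans (by omega)) ?_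
    refine natDegree_mul_le.trans ?_
    have := key w fun i => hdegsum _
    have h2 : (D ^ e).natDegree ≤ e * d := natDegree_pow_le
    omega
  have hroot : (Finset.univ.filter fun y : K => D.eval y ^ (e * (Q + 1)) = ε) ⊆
      G.roots.toFinset := by
    intro y hy
    rw [Finset.mem_filter] at hy
    have hy := hy.2
    have hDy : D.eval y ≠ 0 := by
      intro h0
      rw [h0, zero_pow (by simp; omega)] at hy
      exact hε hy.symm
    have hq : ∀ a : K, a ^ (Q * Q) = a := fun a => by
      rw [← sq, ← hcard, FiniteField.pow_card]
    rw [Multiset.mem_toFinset, mem_roots hG, IsRoot.def]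
    have hfrob : ∀ a : ℕ → ℕ → K,
        (eval y (∑ i ∈ Finset.range l, (∑ j ∈ Finset.range (m + 1), C (a i j ^ Q) * X ^ j) *
          X ^ (i * Q))) ^ Q =
        ∑ i ∈ Finset.range l, ∑ j ∈ Finset.range (m + 1), a i j * y ^ (j * Q + i) := by
      intro a
      subst hQ
      rw [eval_finsetSum, sum_pow_char_pow]
      refine Finset.sum_congr rfl fun i _ => ?_
      rw [eval_mul, mul_pow, eval_finsetSum, sum_pow_char_pow, Finset.sum_mul]
      refine Finset.sum_congr rfl fun j _ => ?_
      simp only [eval_mul, eval_C, eval_pow, eval_X]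
      rw [mul_pow, ← pow_mul, hq, ← pow_mul, ← pow_mul, mul_assoc i, mul_comm i, pow_mul y _ i, hq]
      ring
    have hrel' := congrArg (eval y) hrel
    simp only [eval_add, eval_finsetSum, eval_smul, eval_mul, eval_pow, eval_X, eval_C, eval_zero,
      smul_eq_mul] at hrel'
    have hGQ : D.eval y ^ e * (eval y G) ^ Q = 0 := by
      simp only [G, v, w, eval_add, eval_mul]
      have hadd : ∀ a b : K, (a + b) ^ Q = a ^ Q + b ^ Q := by
        subst hQ; exact fun a b => add_pow_char_pow a b p s
      rw [hadd, hfrob, mul_pow, hfrob, ← hrel', eval_pow, mul_add, ← mul_assoc, ← pow_mul,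
        ← pow_add, show e + e * Q = e * (Q + 1) by ring, hy, Finset.mul_sum, Finset.mul_sum]
      congr 1
      · refine Finset.sum_congr rfl fun i _ => ?_
        rw [Finset.mul_sum]
        refine Finset.sum_congr rfl fun j _ => by ring
      · refine Finset.sum_congr rfl fun i _ => ?_
        rw [Finset.mul_sum]
        refine Finset.sum_congr rfl fun j _ => by ring
    exact eq_zero_of_pow_eq_zero ((mul_eq_zero.1 hGQ).resolve_left (pow_ne_zero _ hDy))
  have h1 := (Finset.card_le_card hroot).trans
    ((Multiset.toFinset_card_le _).trans ((card_roots' G).trans hdegG))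
  have hl1 : l - 1 = e + d + 1 := by omega
  rw [hl1] at h1
  calc _ ≤ 2 * (e * d + m + (e + d + 1) * Q) := Nat.mul_le_mul_left _ h1
    _ ≤ _ := by
      subst hem
      rw [← he]
      nlinarith

end Stepanov

section Stepanov

open Polynomial

theorem abs_sum_quadraticChar_le_of_coeff_zero_ne {K : Type*} [Field K] [Fintype K] [DecidableEq K]
    {p : ℕ} [Fact p.Prime] [CharP K p] (hp : p ≠ 2) {s Q : ℕ} (hQ : Q = p ^ s)
    (hcard : Fintype.card K = Q ^ 2) {D : K[X]} (hD : Squarefree D) (hdeg : 0 < D.natDegree)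
    (hD0 : D.coeff 0 ≠ 0) (hdQ : 4 * D.natDegree + 1 ≤ Q) :
    |∑ y : K, quadraticChar K (D.eval y)| ≤ (4 * D.natDegree + 2) * Q := by
  have hchar : ringChar K ≠ 2 := by rwa [ringChar.eq K p]
  have hodd : Odd Q := hQ ▸ ((Fact.out : p.Prime).odd_of_ne_two hp).pow
  obtain ⟨e, he⟩ := hodd
  obtain ⟨m, hm⟩ := Nat.exists_eq_add_of_le (show D.natDegree ≤ e by omega)
  have key := fun ε => two_mul_card_pow_eq_le (ε := ε) hQ he.symm hcard hD hdeg hD0 hm (by omega)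
  have hχ : ∀ a : K, (quadraticChar K a : K) = a ^ (e * (Q + 1)) := fun a => by
    rw [quadraticChar_eq_pow_of_char_ne_two' hchar, hcard]
    congr 1
    rw [Nat.div_eq_of_lt_le] <;> subst he <;> nlinarith
  have h1 := key 1 one_ne_zero
  have h2 := key (-1) (by simp)
  have hne : (1 : K) ≠ -1 := (Ring.neg_one_ne_one_of_char_ne_two hchar).symm
  have hz : (Finset.univ.filter fun y : K => D.eval y = 0).card ≤ D.natDegree := by
    refine (Finset.card_le_card (t := D.roots.toFinset) fun y hy => ?_).trans
      ((Multiset.toFinset_card_le _).trans (card_roots' D))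
    rw [Multiset.mem_toFinset, mem_roots hD.ne_zero]
    exact (Finset.mem_filter.1 hy).2
  have hcases : ∀ y : K, quadraticChar K (D.eval y) =
      (if D.eval y ^ (e * (Q + 1)) = 1 then (1 : ℤ) else 0) -
        (if D.eval y ^ (e * (Q + 1)) = -1 then (1 : ℤ) else 0) ∧
      (1 : ℤ) = (if D.eval y ^ (e * (Q + 1)) = 1 then (1 : ℤ) else 0) +
        (if D.eval y ^ (e * (Q + 1)) = -1 then (1 : ℤ) else 0) + if D.eval y = 0 then 1 else 0 := by
    intro y
    rw [← hχ]
    by_cases h : D.eval y = 0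
    · simp [h]
    · rcases quadraticChar_dichotomy h with h' | h' <;> rw [h'] <;> simp [hne, hne.symm, h]
  have hsum := Finset.sum_congr (rfl : (Finset.univ : Finset K) = _) fun y _ => (hcases y).1
  have hone := Finset.sum_congr (rfl : (Finset.univ : Finset K) = _) fun y _ => (hcases y).2
  rw [Finset.sum_sub_distrib] at hsum
  rw [Finset.sum_add_distrib, Finset.sum_add_distrib] at hone
  simp only [Finset.sum_boole, Finset.sum_const, Finset.card_univ, hcard, nsmul_eq_mul,
    mul_one] at hsum hone
  rw [hsum, abs_le]
  zify at h1 h2 hz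
  push_cast at hone
  have hQ1 : (1 : ℤ) ≤ Q := by omega
  have : (D.natDegree : ℤ) ≤ D.natDegree * Q := le_mul_of_one_le_right (by positivity) hQ1
  constructor <;> nlinarith

theorem abs_sum_quadraticChar_le {K : Type*} [Field K] [Fintype K] [DecidableEq K]
    {p : ℕ} [Fact p.Prime] [CharP K p] (hp : p ≠ 2) {s Q : ℕ} (hQ : Q = p ^ s)
    (hcard : Fintype.card K = Q ^ 2) {D : K[X]} (hD : Squarefree D) (hdeg : 0 < D.natDegree)
    (hdQ : 4 * D.natDegree + 1 ≤ Q) :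
    |∑ y : K, quadraticChar K (D.eval y)| ≤ (4 * D.natDegree + 2) * Q := by
  obtain ⟨a, ha⟩ : ∃ a, D.eval a ≠ 0 := by
    by_contra! h
    refine hD.ne_zero (eq_zero_of_natDegree_lt_card_of_eval_eq_zero D Function.injective_id h ?_)
    rw [hcard]
    nlinarith
  have hsq : Squarefree (taylor a D) := by
    intro x hx
    have h := map_dvd (taylorEquiv a).symm hx
    rw [map_mul] at h
    have h2 : (taylorEquiv a).symm (taylor a D) = D := (taylorEquiv a).symm_apply_apply D
    rw [h2] at h
    exact (isUnit_map_iff (taylorEquiv a).symm x).1 (hD _ h)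
  have := abs_sum_quadraticChar_le_of_coeff_zero_ne hp hQ hcard hsq (by simpa using hdeg)
    (by simpa [taylor_coeff_zero] using ha) (by simpa using hdQ)
  rw [natDegree_taylor] at this
  convert this using 2
  rw [← Equiv.sum_comp (Equiv.addRight a)]
  simp [taylor_apply]

end Stepanov

/-- The Kloosterman sum over a finite ring attached to an additive character `ψ`. -/
noncomputable def ringKloosterman {R : Type*} [CommRing R] [Fintype Rˣ] (ψ : AddChar R ℂ)
    (h m : R) : ℂ :=
  ∑ x : Rˣ, ψ (h * x + m * ((x⁻¹ : Rˣ) : R))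

section FiniteField

open Polynomial

theorem card_filter_sq_eq {K : Type*} [Field K] [Fintype K] [DecidableEq K] (hK : ringChar K ≠ 2)
    (a : K) : ((Finset.univ.filter fun w : K => w ^ 2 = a).card : ℤ) = quadraticChar K a + 1 := by
  rw [← quadraticChar_card_sqrts hK]
  congr 2
  ext w
  simp

theorem card_filter_units_eq {K : Type*} [Field K] [Fintype K] [DecidableEq K]
    (hK : ringChar K ≠ 2) {h m : K} (hh : h ≠ 0) (hm : m ≠ 0) (u : K) :
    ((Finset.univ.filter fun x : Kˣ => h * x + m * ((x⁻¹ : Kˣ) : K) = u).card : ℤ) =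
      quadraticChar K (u ^ 2 - 4 * (h * m)) + 1 := by
  have h2 : (2 : K) ≠ 0 := Ring.two_ne_zero hK
  rw [← card_filter_sq_eq hK]
  congr 1
  refine Finset.card_bij (fun x _ => 2 * h * x - u) ?_ ?_ ?_
  · intro x hx
    rw [Finset.mem_filter] at hx ⊢
    refine ⟨Finset.mem_univ _, ?_⟩
    rw [← hx.2, Units.val_inv_eq_inv_val]
    field_simp
    ring
  · intro x _ y _ hxy
    refine Units.ext (mul_left_cancel₀ (mul_ne_zero h2 hh) ?_)
    linear_combination hxy
  · intro w hw
    rw [Finset.mem_filter] at hw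
    have hw := hw.2
    have hwu : w + u ≠ 0 := by
      intro h0
      have : 4 * (h * m) = 0 := by linear_combination (u - w) * h0 + hw
      have h4 : (4 : K) = 2 * 2 := by norm_num
      rw [h4] at this
      simp [h2, hh, hm] at this
    refine ⟨Units.mk0 ((w + u) / (2 * h)) (div_ne_zero hwu (mul_ne_zero h2 hh)), ?_, ?_⟩
    · rw [Finset.mem_filter]
      refine ⟨Finset.mem_univ _, ?_⟩
      rw [Units.val_inv_eq_inv_val, Units.val_mk0]
      field_simp
      linear_combination hw
    · rw [Units.val_mk0]
      field_simp
      ring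

theorem ringKloosterman_eq_sum_quadraticChar {K : Type*} [Field K] [Fintype K] [DecidableEq K]
    (hK : ringChar K ≠ 2) {ψ : AddChar K ℂ} (hψ : ψ ≠ 1) {h m : K} (hh : h ≠ 0) (hm : m ≠ 0) :
    ringKloosterman ψ h m = ∑ u, ψ u * (quadraticChar K (u ^ 2 - 4 * (h * m)) : ℂ) := by
  have h1 : ringKloosterman ψ h m =
      ∑ u, ψ u * ((quadraticChar K (u ^ 2 - 4 * (h * m)) + 1 : ℤ) : ℂ) := by
    rw [ringKloosterman,
      ← Finset.sum_fiberwise Finset.univ (fun x : Kˣ => h * x + m * ((x⁻¹ : Kˣ) : K))]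
    refine Finset.sum_congr rfl fun u _ => ?_
    rw [← card_filter_units_eq hK hh hm, Finset.sum_congr rfl (g := fun _ => ψ u)
      (fun x hx => by rw [(Finset.mem_filter.1 hx).2])]
    simp [mul_comm]
  rw [h1]
  push_cast
  simp_rw [mul_add, Finset.sum_add_distrib, mul_one, AddChar.sum_eq_zero_of_ne_one hψ, add_zero]

theorem squarefree_artinSchreier_sq_sub {K : Type*} [Field K] {p : ℕ} [Fact p.Prime]
    [CharP K p] (hp : p ≠ 2) (ρ : K) {c : K} (hc : c ≠ 0) :
    Squarefree ((X ^ p - X + C ρ) ^ 2 - C (4 * c)) := by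
  have hK : ringChar K ≠ 2 := by rwa [ringChar.eq K p]
  have h2 : (2 : K) ≠ 0 := Ring.two_ne_zero hK
  have h4 : (4 : K) ≠ 0 := by
    rw [show (4 : K) = 2 * 2 by norm_num]; exact mul_ne_zero h2 h2
  refine Separable.squarefree ?_
  rw [separable_def']
  refine ⟨-C (4 * c)⁻¹, -(C (4 * c)⁻¹ * C 2⁻¹) * (X ^ p - X + C ρ), ?_⟩
  have hder : derivative ((X ^ p - X + C ρ) ^ 2 - C (4 * c)) = - C 2 * (X ^ p - X + C ρ) := by
    simp [derivative_pow]
  have e1 : C (4 * c)⁻¹ * C (4 * c) = (1 : K[X]) := by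
    rw [← C_mul, inv_mul_cancel₀ (mul_ne_zero h4 hc), C_1]
  have e2 : C (2⁻¹ : K) * C 2 = (1 : K[X]) := by rw [← C_mul, inv_mul_cancel₀ h2, C_1]
  rw [hder]
  linear_combination e1 + C (4 * c)⁻¹ * (X ^ p - X + C ρ) ^ 2 * e2

theorem natDegree_artinSchreier_sq_sub {K : Type*} [Field K] {p : ℕ} (hp : 1 < p) (ρ c : K) :
    ((X ^ p - X + C ρ) ^ 2 - C c).natDegree = 2 * p := by
  rw [natDegree_sub_C, natDegree_pow, natDegree_add_C, natDegree_sub_eq_left_of_natDegree_lt]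
  · simp
  · simpa using hp

theorem norm_ringKloosterman_le {K : Type*} [Field K] [Fintype K] [DecidableEq K] {p : ℕ}
    [Fact p.Prime] [CharP K p] (hp : p ≠ 2) {s Q : ℕ} (hQ : Q = p ^ s)
    (hcard : Fintype.card K = Q ^ 2) (hpQ : 8 * p + 1 ≤ Q) {ψ : AddChar K ℂ} (hψ : ψ ≠ 1)
    (hfrob : ∀ y, ψ (y ^ p) = ψ y) {h m : K} (hh : h ≠ 0) (hm : m ≠ 0) :
    ‖ringKloosterman ψ h m‖ ≤ (8 * p + 2) * Q := by
  have hK : ringChar K ≠ 2 := by rwa [ringChar.eq K p]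
  have hp1 : 1 < p := (Fact.out : p.Prime).one_lt
  have hAS : ∀ y, ψ (y ^ p - y) = 1 := fun y => by
    rw [AddChar.map_sub_eq_div, hfrob, div_self (ψ.val_isUnit y).ne_zero]
  have hcard0 : (0 : ℝ) < Fintype.card K := by exact_mod_cast Fintype.card_pos
  set S := ringKloosterman ψ h m with hS
  rw [ringKloosterman_eq_sum_quadraticChar hK hψ hh hm] at hS
  have havg : (Fintype.card K : ℂ) * S = ∑ ρ, ψ ρ *
      ((∑ y, quadraticChar K ((((X : K[X]) ^ p - X + C ρ) ^ 2 - C (4 * (h * m))).eval y) : ℤ) : ℂ) := by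
    have h1 : ∀ y : K, S = ∑ ρ, ψ ρ * (quadraticChar K ((y ^ p - y + ρ) ^ 2 - 4 * (h * m)) : ℂ) := by
      intro y
      rw [hS, ← Equiv.sum_comp (Equiv.addLeft (y ^ p - y))]
      refine Finset.sum_congr rfl fun ρ _ => ?_
      simp only [Equiv.coe_addLeft]
      rw [AddChar.map_add_eq_mul, hAS, one_mul]
    calc (Fintype.card K : ℂ) * S = ∑ y : K, S := by simp
      _ = ∑ y : K, ∑ ρ, ψ ρ * (quadraticChar K ((y ^ p - y + ρ) ^ 2 - 4 * (h * m)) : ℂ) :=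
        Finset.sum_congr rfl fun y _ => h1 y
      _ = _ := by
        rw [Finset.sum_comm]
        refine Finset.sum_congr rfl fun ρ _ => ?_
        simp [Finset.mul_sum]
  have hbound : ‖(Fintype.card K : ℂ) * S‖ ≤ ∑ _ρ : K, ((8 * p + 2) * Q : ℝ) := by
    rw [havg]
    refine norm_sum_le_of_le _ fun ρ _ => ?_
    have := abs_sum_quadraticChar_le hp hQ hcard
      (squarefree_artinSchreier_sq_sub hp ρ (mul_ne_zero hh hm))
      (by rw [natDegree_artinSchreier_sq_sub hp1]; omega)
      (by rw [natDegree_artinSchreier_sq_sub hp1]; omega)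
    rw [natDegree_artinSchreier_sq_sub hp1] at this
    rw [norm_mul, AddChar.norm_apply, one_mul, Complex.norm_intCast]
    have h3 : ((|∑ y, quadraticChar K ((((X : K[X]) ^ p - X + C ρ) ^ 2 - C (4 * (h * m))).eval y)| :
      ℤ) : ℝ) ≤ (((4 * ((2 * p : ℕ) : ℤ) + 2) * Q : ℤ) : ℝ) := by exact_mod_cast this
    push_cast at h3 ⊢
    linarith
  rw [norm_mul, Complex.norm_natCast, Finset.sum_const, Finset.card_univ, nsmul_eq_mul] at hbound
  exact le_of_mul_le_mul_left hbound hcard0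

end FiniteField

section Doubling

theorem sum_units_eq_sum_ite {K M : Type*} [Field K] [Fintype K] [DecidableEq K]
    [AddCommMonoid M] (f : K → M) : ∑ x : Kˣ, f x = ∑ x : K, if x = 0 then 0 else f x := by
  have hite : ∀ x : K, (if x = 0 then 0 else f x) = if x ≠ 0 then f x else 0 := by simp
  simp_rw [hite]
  rw [← Finset.sum_filter]
  refine Finset.sum_bij (fun x _ => (x : K)) ?_ ?_ ?_ ?_
  · simp
  · intro x _ y _ h
    exact Units.ext h
  · intro y hy
    exact ⟨Units.mk0 y (by simpa using hy), Finset.mem_univ _, rfl⟩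
  · simp

theorem ringKloosterman_eq_sum_ite {K : Type*} [Field K] [Fintype K] [DecidableEq K]
    (ψ : AddChar K ℂ) (h m : K) :
    ringKloosterman ψ h m = ∑ x : K, if x = 0 then 0 else ψ (h * x + m * x⁻¹) := by
  rw [← sum_units_eq_sum_ite fun x => ψ (h * x + m * x⁻¹)]
  simp [ringKloosterman]

/-- The sum over pairs `(a, b)` of `ψ (2 a (h + m / n))`, where `n = a² - g b² ≠ 0`. For `g` a
nonsquare it is the Kloosterman sum of the extension generated by a square root of `g`, and for
`g = 1` it is the square of the Kloosterman sum of the base field. -/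
noncomputable def normFormSum {K : Type*} [Field K] [Fintype K] [DecidableEq K]
    (ψ : AddChar K ℂ) (h m g : K) : ℂ :=
  ∑ a : K, ∑ b : K, if a ^ 2 - g * b ^ 2 = 0 then 0
    else ψ (2 * a * (h + m * (a ^ 2 - g * b ^ 2)⁻¹))

theorem normFormSum_eq {K : Type*} [Field K] [Fintype K] [DecidableEq K] (hK : ringChar K ≠ 2)
    (ψ : AddChar K ℂ) (h m : K) {g : K} (hg : g ≠ 0) :
    normFormSum ψ h m g = ∑ a : K, ∑ n : K, (if n = 0 then 0 else ψ (2 * a * (h + m * n⁻¹))) *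
      ((quadraticChar K g * quadraticChar K (a ^ 2 - n) + 1 : ℤ) : ℂ) := by
  refine Finset.sum_congr rfl fun a _ => ?_
  rw [← Finset.sum_fiberwise Finset.univ (fun b : K => a ^ 2 - g * b ^ 2)]
  refine Finset.sum_congr rfl fun n _ => ?_
  rw [Finset.sum_congr rfl (g := fun _ => if n = 0 then 0 else ψ (2 * a * (h + m * n⁻¹)))
    (fun b hb => by rw [(Finset.mem_filter.1 hb).2])]
  have h1 : (Finset.univ.filter fun b : K => a ^ 2 - g * b ^ 2 = n) =
      Finset.univ.filter fun b : K => b ^ 2 = (a ^ 2 - n) / g := by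
    ext b
    simp only [Finset.mem_filter, Finset.mem_univ, true_and]
    rw [eq_div_iff hg]
    constructor <;> intro h <;> linear_combination -h
  have h2 : quadraticChar K ((a ^ 2 - n) / g) = quadraticChar K g * quadraticChar K (a ^ 2 - n) := by
    have : (a ^ 2 - n) / g = g * (a ^ 2 - n) * (g⁻¹) ^ 2 := by field_simp
    rw [this, map_mul, map_mul, quadraticChar_sq_one' (inv_ne_zero hg), mul_one]
  rw [Finset.sum_const, nsmul_eq_mul, mul_comm, h1, ← h2, ← card_filter_sq_eq hK]
  simp

theorem normFormSum_add_normFormSum_one {K : Type*} [Field K] [Fintype K] [DecidableEq K]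
    (hK : ringChar K ≠ 2) {ψ : AddChar K ℂ} (hψ : ψ ≠ 1) {h m : K} (hh : h ≠ 0) (hm : m ≠ 0)
    {g : K} (hg : quadraticChar K g = -1) :
    normFormSum ψ h m g + normFormSum ψ h m 1 = 2 * Fintype.card K := by
  have h2 : (2 : K) ≠ 0 := Ring.two_ne_zero hK
  have hg0 : g ≠ 0 := by rintro rfl; simp at hg
  rw [normFormSum_eq hK ψ h m hg0, normFormSum_eq hK ψ h m one_ne_zero, hg, map_one,
    ← Finset.sum_add_distrib]
  simp_rw [← Finset.sum_add_distrib]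
  rw [Finset.sum_comm]
  have hn0 : -(m / h) ≠ 0 := neg_ne_zero.2 (div_ne_zero hm hh)
  rw [Finset.sum_eq_single (-(m / h))]
  · have : h + m * (-(m / h))⁻¹ = 0 := by field_simp; ring
    have hc : ∀ a : K, (if -(m / h) = 0 then (0 : ℂ) else ψ (2 * a * (h + m * (-(m / h))⁻¹))) = 1 := by
      intro a
      rw [if_neg hn0, this, mul_zero, AddChar.map_zero_eq_one]
    simp_rw [hc, one_mul]
    rw [Finset.sum_congr rfl (g := fun _ => (2 : ℂ)) (fun a _ => by push_cast; ring)]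
    simp [mul_comm]
  · intro n _ hn
    by_cases hn0 : n = 0
    · simp [hn0]
    · simp only [if_neg hn0]
      have hne : 2 * (h + m * n⁻¹) ≠ 0 := by
        refine mul_ne_zero h2 fun h0 => hn ?_
        field_simp at h0 ⊢
        linear_combination h0
      have hprim := AddChar.sum_eq_zero_of_ne_one (AddChar.IsPrimitive.of_ne_one hψ hne)
      simp only [AddChar.mulShift_apply] at hprim
      calc _ = ∑ a, 2 * ψ (2 * (h + m * n⁻¹) * a) := by
            refine Finset.sum_congr rfl fun a _ => ?_
            rw [show 2 * a * (h + m * n⁻¹) = 2 * (h + m * n⁻¹) * a by ring]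
            push_cast
            ring
        _ = 0 := by rw [← Finset.mul_sum, hprim, mul_zero]
  · simp

theorem normFormSum_one {K : Type*} [Field K] [Fintype K] [DecidableEq K]
    (hK : ringChar K ≠ 2) (ψ : AddChar K ℂ) (h m : K) :
    normFormSum ψ h m 1 = ringKloosterman ψ h m ^ 2 := by
  have h2 : (2 : K) ≠ 0 := Ring.two_ne_zero hK
  rw [ringKloosterman_eq_sum_ite, sq, Finset.sum_mul_sum, normFormSum, ← Fintype.sum_prod_type',
    ← Fintype.sum_prod_type']
  let e : K × K ≃ K × K :=
    { toFun := fun x => (x.1 + x.2, x.1 - x.2)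
      invFun := fun x => ((x.1 + x.2) / 2, (x.1 - x.2) / 2)
      left_inv := fun x => by ext <;> dsimp only <;> field_simp <;> ring
      right_inv := fun x => by ext <;> dsimp only <;> field_simp <;> ring }
  refine Fintype.sum_equiv e _ _ ?_
  rintro ⟨a, b⟩
  simp only [e, Equiv.coe_fn_mk]
  have hf : a ^ 2 - 1 * b ^ 2 = (a + b) * (a - b) := by ring
  rw [hf]
  by_cases h₁ : a + b = 0
  · simp [h₁]
  by_cases h₂ : a - b = 0
  · simp [h₂]
  rw [if_neg (mul_ne_zero h₁ h₂), if_neg h₁, if_neg h₂, ← AddChar.map_add_eq_mul]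
  congr 1
  field_simp
  ring

theorem normFormSum_eq_ringKloosterman {K : Type*} [Field K] [Fintype K] [DecidableEq K]
    (ψ : AddChar K ℂ) (h m g : K) [Fact (∀ r : K, r ^ 2 ≠ g + 0 * r)]
    [Fintype (QuadraticAlgebra K g 0)] [DecidableEq (QuadraticAlgebra K g 0)] :
    ringKloosterman (ψ.compAddMonoidHom (QuadraticAlgebra.trace (a := g) (b := 0)).toAddMonoidHom)
      (algebraMap K _ h) (algebraMap K _ m) = normFormSum ψ h m g := by
  rw [ringKloosterman_eq_sum_ite, normFormSum, ← Fintype.sum_prod_type']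
  refine Fintype.sum_equiv (QuadraticAlgebra.equivProd g 0) _ _ fun z => ?_
  have hn : z.norm = z.re ^ 2 - g * z.im ^ 2 := by rw [QuadraticAlgebra.norm_def]; ring
  have e1 : (QuadraticAlgebra.equivProd g 0 z).1 = z.re := rfl
  have e2 : (QuadraticAlgebra.equivProd g 0 z).2 = z.im := rfl
  rw [e1, e2, ← hn]
  by_cases hz : z = 0
  · simp [hz]
  have hz' : z.norm ≠ 0 := QuadraticAlgebra.norm_eq_zero_iff_eq_zero.not.2 hz
  rw [if_neg hz, if_neg hz', AddChar.compAddMonoidHom_apply]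
  congr 1
  have hinv : z⁻¹ = z.norm⁻¹ • star z := by
    refine inv_eq_of_mul_eq_one_right ?_
    rw [mul_smul_comm, ← QuadraticAlgebra.algebraMap_norm_eq_mul_star, Algebra.smul_def,
      ← map_mul, inv_mul_cancel₀ hz', map_one]
  rw [hinv, ← Algebra.smul_def, ← Algebra.smul_def, LinearMap.toAddMonoidHom_coe, map_add, map_smul,
    map_smul, map_smul, QuadraticAlgebra.trace_star, QuadraticAlgebra.trace_def]
  simp only [smul_eq_mul]
  ring

end Doubling

section Growth

/-- `S` is the value of a nondegenerate Kloosterman sum over some field with `N` elements, of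
characteristic `p`, for an additive character invariant under Frobenius. -/
def IsKloostermanValue (p N : ℕ) (S : ℂ) : Prop :=
  ∃ (K : Type) (_ : Field K) (_ : Fintype K) (_ : DecidableEq K) (_ : CharP K p)
    (ψ : AddChar K ℂ) (h m : K), Fintype.card K = N ∧ ψ ≠ 1 ∧ (∀ y, ψ (y ^ p) = ψ y) ∧ h ≠ 0 ∧
      m ≠ 0 ∧ ringKloosterman ψ h m = S

theorem IsKloostermanValue.double {p N : ℕ} [Fact p.Prime] (hp : p ≠ 2) {S : ℂ}
    (hS : IsKloostermanValue p N S) : IsKloostermanValue p (N ^ 2) (2 * N - S ^ 2) := by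
  obtain ⟨K, _, _, _, _, ψ, h, m, hcard, hψ, hfrob, hh, hm, rfl⟩ := hS
  have hK : ringChar K ≠ 2 := by rwa [ringChar.eq K p]
  have h2 : (2 : K) ≠ 0 := Ring.two_ne_zero hK
  obtain ⟨g, hg⟩ := quadraticChar_exists_neg_one hK
  have hsq : ∀ r : K, r ^ 2 ≠ g + 0 * r := by
    intro r hr
    rw [zero_mul, add_zero] at hr
    rw [quadraticChar_neg_one_iff_not_isSquare] at hg
    exact hg ⟨r, by rw [← hr, sq]⟩
  have : Fact (∀ r : K, r ^ 2 ≠ g + 0 * r) := ⟨hsq⟩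
  let E := QuadraticAlgebra K g 0
  let _ : Fintype E := Fintype.ofEquiv _ (QuadraticAlgebra.equivProd g 0).symm
  let _ : DecidableEq E := Classical.decEq _
  have hchar : CharP E p := charP_of_injective_algebraMap (algebraMap K E).injective p
  let tr : E →+ K := (QuadraticAlgebra.trace (a := g) (b := 0)).toAddMonoidHom
  have htr : ∀ z : E, algebraMap K E (tr z) = z + star z := fun z =>
    QuadraticAlgebra.algebraMap_trace_eq_add_star z
  refine ⟨E, inferInstance, inferInstance, inferInstance, hchar, ψ.compAddMonoidHom tr,
    algebraMap K E h, algebraMap K E m, ?_, ?_, ?_, ?_, ?_, ?_⟩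
  · rw [← hcard, Fintype.card_congr (QuadraticAlgebra.equivProd g 0), Fintype.card_prod, sq]
  · intro h1
    refine hψ ?_
    ext y
    have hy : tr (algebraMap K E (y / 2)) = y := by
      apply (algebraMap K E).injective
      rw [htr]
      have hstar : ∀ c : K, star (algebraMap K E c) = algebraMap K E c := fun c => by
        ext <;> simp [E, QuadraticAlgebra.algebraMap_eq]
      rw [hstar, ← map_add]
      congr 1
      field_simp
      ring
    have := DFunLike.congr_fun h1 (algebraMap K E (y / 2))
    rwa [AddChar.compAddMonoidHom_apply, hy] at this
  · intro z
    rw [AddChar.compAddMonoidHom_apply, AddChar.compAddMonoidHom_apply, ← hfrob (tr z)]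
    congr 1
    apply (algebraMap K E).injective
    rw [htr, map_pow, htr, add_pow_char, star_pow]
  · simpa using hh
  · simpa using hm
  · rw [normFormSum_eq_ringKloosterman, ← hcard,
      ← normFormSum_add_normFormSum_one hK hψ hh hm hg, normFormSum_one hK]
    ring

theorem IsKloostermanValue.norm_le {p s Q : ℕ} [Fact p.Prime] (hp : p ≠ 2) {S : ℂ}
    (hQ : Q = p ^ s) (hpQ : 8 * p + 1 ≤ Q) (hS : IsKloostermanValue p (Q ^ 2) S) :
    ‖S‖ ≤ (8 * p + 2) * Q := by
  obtain ⟨K, _, _, _, _, ψ, h, m, hcard, hψ, hfrob, hh, hm, rfl⟩ := hS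
  exact norm_ringKloosterman_le hp hQ hcard hpQ hψ hfrob hh hm

theorem IsKloostermanValue.exists_iterate {p : ℕ} [Fact p.Prime] (hp : p ≠ 2) {S : ℂ}
    (hS : IsKloostermanValue p p S) {δ : ℝ} (hδ : 0 ≤ δ) (h : (2 + δ) * √p ≤ ‖S‖) (n : ℕ) :
    ∃ T, IsKloostermanValue p (p ^ 2 ^ n) T ∧ (2 + 4 ^ n * δ) * √((p : ℝ) ^ 2 ^ n) ≤ ‖T‖ := by
  induction n with
  | zero => exact ⟨S, by simpa using hS, by simpa using h⟩
  | succ n ih =>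
    obtain ⟨T, hT, hle⟩ := ih
    refine ⟨_, by simpa [← pow_mul, ← pow_succ] using hT.double hp, ?_⟩
    set q : ℝ := (p : ℝ) ^ 2 ^ n with hq
    have hq0 : 0 ≤ q := by positivity
    have hsq : √((p : ℝ) ^ 2 ^ (n + 1)) = q := by
      rw [pow_succ, pow_mul, Real.sqrt_sq hq0]
    rw [hsq]
    have h1 : ‖T ^ 2‖ - ‖(2 * (p : ℂ) ^ 2 ^ n)‖ ≤ ‖2 * (p : ℂ) ^ 2 ^ n - T ^ 2‖ := by
      rw [norm_sub_rev]
      exact norm_sub_norm_le _ _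
    have h2 : ‖(2 * (p : ℂ) ^ 2 ^ n)‖ = 2 * q := by simp [hq]
    rw [h2, norm_pow] at h1
    refine le_trans ?_ h1
    have h3 := pow_le_pow_left₀ (by positivity) hle 2
    rw [mul_pow, Real.sq_sqrt hq0] at h3
    have hd : 0 ≤ 4 ^ n * δ := by positivity
    rw [pow_succ]
    nlinarith [mul_nonneg (mul_nonneg hd hd) hq0]

theorem norm_ringKloosterman_zmod_le {p : ℕ} [Fact p.Prime] (hp : p ≠ 2) {ψ : AddChar (ZMod p) ℂ}
    (hψ : ψ ≠ 1) {h m : ZMod p} (hh : h ≠ 0) (hm : m ≠ 0) :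
    ‖ringKloosterman ψ h m‖ ≤ 2 * √p := by
  have hp2 : 2 ≤ p := (Fact.out : p.Prime).two_le
  have hp0 : (0 : ℝ) < √p := Real.sqrt_pos.2 (by positivity)
  by_contra! hlt
  set δ : ℝ := ‖ringKloosterman ψ h m‖ / √p - 2 with hδ
  have hδ0 : 0 < δ := by rw [hδ, sub_pos, lt_div_iff₀ hp0]; exact hlt
  have hS : IsKloostermanValue p p (ringKloosterman ψ h m) :=
    ⟨ZMod p, inferInstance, inferInstance, inferInstance, inferInstance, ψ, h, m, ZMod.card p, hψ,
      fun y => by rw [ZMod.pow_card], hh, hm, rfl⟩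
  have hle : (2 + δ) * √p ≤ ‖ringKloosterman ψ h m‖ := by
    rw [hδ, add_sub_cancel, div_mul_cancel₀ _ hp0.ne']
  obtain ⟨n, hn⟩ := pow_unbounded_of_one_lt ((8 * p + 2) / δ + 8 * p + 1) (by norm_num : (1 : ℝ) < 2)
  have hn1 : ((8 * p + 2) / δ : ℝ) < 2 ^ n := by
    have : (0 : ℝ) ≤ 8 * p + 1 := by positivity
    linarith
  have hn2 : 8 * p + 1 < 2 ^ n := by
    have : (0 : ℝ) ≤ (8 * p + 2) / δ := by positivity
    exact_mod_cast (by push_cast; linarith : ((8 * p + 1 : ℕ) : ℝ) < 2 ^ n)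
  obtain ⟨T, hT, hTle⟩ := hS.exists_iterate hp hδ0.le hle (n + 1)
  set Q := p ^ 2 ^ n with hQ
  have hQ2 : p ^ 2 ^ (n + 1) = Q ^ 2 := by rw [hQ, ← pow_mul, ← pow_succ]
  have hQr : √((p : ℝ) ^ 2 ^ (n + 1)) = Q := by
    rw [show (p : ℝ) ^ 2 ^ (n + 1) = (Q : ℝ) ^ 2 by exact_mod_cast hQ2]
    exact Real.sqrt_sq (by positivity)
  have hQge : 8 * p + 1 ≤ Q :=
    hn2.le.trans ((Nat.pow_le_pow_right (by norm_num) (Nat.lt_two_pow_self).le).trans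
      (Nat.pow_le_pow_left hp2 _))
  rw [hQ2] at hT
  have hup := hT.norm_le hp hQ hQge
  rw [hQr] at hTle
  have hQ0 : (0 : ℝ) < Q := by positivity
  have h3 : 2 + 4 ^ (n + 1) * δ ≤ 8 * p + 2 := le_of_mul_le_mul_right (hTle.trans hup) hQ0
  have h4 : (8 * p + 2 : ℝ) < 2 ^ n * δ := by rwa [div_lt_iff₀ hδ0] at hn1
  have h5 : (2 : ℝ) ^ n ≤ 4 ^ (n + 1) :=
    (pow_le_pow_left₀ (by norm_num) (by norm_num) n).trans
      (pow_le_pow_right₀ (by norm_num) n.le_succ)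
  nlinarith [mul_le_mul_of_nonneg_right h5 hδ0.le]

end Growth

section FiniteRing

variable {R : Type*} [CommRing R] [Fintype R] [DecidableEq R] [Fintype Rˣ]

omit [DecidableEq R] in
theorem norm_ringKloosterman_le_card_units (ψ : AddChar R ℂ) (h m : R) :
    ‖ringKloosterman ψ h m‖ ≤ Fintype.card Rˣ := by
  refine (norm_sum_le _ _).trans ?_
  simp [AddChar.norm_apply]

/-- The units `x` which are stationary, up to the annihilator of `n`, for `h x + m / x`. -/
def stationaryUnits (h m n : R) : Finset Rˣ :=
  Finset.univ.filter fun x : Rˣ => n * (h * x - m * ((x⁻¹ : Rˣ) : R)) = 0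

omit [Fintype R] in
theorem mem_stationaryUnits {h m n : R} {x : Rˣ} :
    x ∈ stationaryUnits h m n ↔ n * (h * x - m * ((x⁻¹ : Rˣ) : R)) = 0 := by
  simp [stationaryUnits]

theorem ringKloosterman_eq_sum_stationaryUnits {ψ : AddChar R ℂ} (hψ : ψ.IsPrimitive) (h m : R)
    {n : R} (hn : n ^ 2 = 0) :
    ringKloosterman ψ h m =
      ∑ x ∈ stationaryUnits h m n, ψ (h * x + m * ((x⁻¹ : Rˣ) : R)) := by
  have hcard : (Fintype.card R : ℂ) ≠ 0 := by exact_mod_cast Fintype.card_ne_zero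
  refine mul_left_cancel₀ hcard ?_
  let u : R → Rˣ := fun t =>
    ⟨1 + n * t, 1 - n * t, by linear_combination -t ^ 2 * hn, by linear_combination -t ^ 2 * hn⟩
  have hshift : ∀ t : R, ringKloosterman ψ h m = ∑ x : Rˣ, ψ (h * x + m * ((x⁻¹ : Rˣ) : R)) *
      ψ (t * (n * (h * x - m * ((x⁻¹ : Rˣ) : R)))) := by
    intro t
    rw [ringKloosterman, ← Equiv.sum_comp (Equiv.mulRight (u t))]
    refine Finset.sum_congr rfl fun x _ => ?_
    rw [← AddChar.map_add_eq_mul]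
    have e1 : ((u t : Rˣ) : R) = 1 + n * t := rfl
    have e2 : (((u t)⁻¹ : Rˣ) : R) = 1 - n * t := rfl
    rw [Equiv.coe_mulRight, mul_inv, Units.val_mul, Units.val_mul, e1, e2]
    congr 1
    ring
  calc (Fintype.card R : ℂ) * ringKloosterman ψ h m = ∑ _t : R, ringKloosterman ψ h m := by simp
    _ = ∑ x : Rˣ, ψ (h * x + m * ((x⁻¹ : Rˣ) : R)) *
        ∑ t, ψ (t * (n * (h * x - m * ((x⁻¹ : Rˣ) : R)))) := by
      rw [Finset.sum_congr rfl fun t _ => hshift t, Finset.sum_comm]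
      simp_rw [Finset.mul_sum]
    _ = _ := by
      simp_rw [AddChar.sum_mulShift _ hψ]
      rw [stationaryUnits, Finset.sum_filter, Finset.mul_sum]
      refine Finset.sum_congr rfl fun x _ => ?_
      split_ifs
      · rw [mul_comm]
      · simp

theorem norm_ringKloosterman_le_card_stationaryUnits {ψ : AddChar R ℂ} (hψ : ψ.IsPrimitive)
    (h m : R) {n : R} (hn : n ^ 2 = 0) :
    ‖ringKloosterman ψ h m‖ ≤ (stationaryUnits h m n).card := by
  rw [ringKloosterman_eq_sum_stationaryUnits hψ h m hn]
  refine (norm_sum_le _ _).trans ?_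
  simp [AddChar.norm_apply]

omit [Fintype Rˣ] in
/-- The absolute value of a degenerate quadratic Gauss sum. -/
theorem norm_sq_sum_quadratic {ψ : AddChar R ℂ} (hψ : ψ.IsPrimitive) (c w : R) {v : R}
    (hv : IsUnit (2 * v)) :
    ‖∑ t, ψ (c * (w * t + v * t ^ 2))‖ ^ 2 =
      Fintype.card R * (Finset.univ.filter fun r : R => c * r = 0).card := by
  have key : (∑ t, ψ (c * (w * t + v * t ^ 2))) *
      (starRingEnd ℂ) (∑ t, ψ (c * (w * t + v * t ^ 2))) =
      Fintype.card R * (Finset.univ.filter fun r : R => c * r = 0).card := by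
    rw [map_sum, Finset.mul_sum]
    calc _ = ∑ s : R, ∑ r : R, ψ (c * (w * r + v * r ^ 2)) * ψ (s * (c * (2 * v) * r)) := by
          refine Finset.sum_congr rfl fun s _ => ?_
          rw [Finset.sum_mul, ← Equiv.sum_comp (Equiv.addRight s)]
          refine Finset.sum_congr rfl fun r _ => ?_
          rw [← AddChar.map_neg_eq_conj, ← AddChar.map_add_eq_mul, ← AddChar.map_add_eq_mul,
            Equiv.coe_addRight]
          congr 1
          ring
      _ = ∑ r : R, ψ (c * (w * r + v * r ^ 2)) * ∑ s, ψ (s * (c * (2 * v) * r)) := by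
          rw [Finset.sum_comm]
          simp_rw [Finset.mul_sum]
      _ = ∑ r : R, if c * r = 0 then (Fintype.card R : ℂ) else 0 := by
          refine Finset.sum_congr rfl fun r _ => ?_
          rw [AddChar.sum_mulShift _ hψ]
          have hiff : c * (2 * v) * r = 0 ↔ c * r = 0 := by
            rw [mul_right_comm, hv.mul_left_eq_zero]
          simp only [hiff]
          split_ifs with hr
          · rw [show c * (w * r + v * r ^ 2) = c * r * (w + v * r) by ring, hr, zero_mul,
              AddChar.map_zero_eq_one, one_mul]
          · simp
      _ = _ := by
          rw [← Finset.sum_filter, Finset.sum_const, nsmul_eq_mul, mul_comm]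
  rw [Complex.mul_conj, Complex.normSq_eq_norm_sq] at key
  exact_mod_cast key

theorem norm_ringKloosterman_mul_sqrt_le {ψ : AddChar R ℂ} (hψ : ψ.IsPrimitive) {h m n c : R}
    (hh : IsUnit h) (h2 : IsUnit (2 : R)) (hn : n ^ 3 = 0) (hc : c ^ 2 = 0) (hcn : c * n = 0)
    (hann : ∀ y, c * y = 0 → n ∣ y) :
    ‖ringKloosterman ψ h m‖ * √(Fintype.card R) ≤ (stationaryUnits h m c).card *
      √((Finset.univ.filter fun r : R => n ^ 2 * r = 0).card) := by
  let u : R → Rˣ := fun t => ⟨1 + n * t, 1 - n * t + n ^ 2 * t ^ 2,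
    by linear_combination t ^ 3 * hn, by linear_combination t ^ 3 * hn⟩
  have e1 : ∀ t, ((u t : Rˣ) : R) = 1 + n * t := fun t => rfl
  have e2 : ∀ t, (((u t)⁻¹ : Rˣ) : R) = 1 - n * t + n ^ 2 * t ^ 2 := fun t => rfl
  set X := stationaryUnits h m c with hX
  set A := (Finset.univ.filter fun r : R => n ^ 2 * r = 0).card with hA
  have hshift : ∀ t : R, ringKloosterman ψ h m = ∑ x ∈ X, ψ (h * x + m * ((x⁻¹ : Rˣ) : R)) *
      ψ (n * t * (h * x - m * ((x⁻¹ : Rˣ) : R)) + n ^ 2 * t ^ 2 * (m * ((x⁻¹ : Rˣ) : R))) := by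
    intro t
    rw [ringKloosterman_eq_sum_stationaryUnits hψ h m hc]
    symm
    refine Finset.sum_equiv (Equiv.mulRight (u t)) (fun x => ?_) fun x _ => ?_
    · rw [hX, mem_stationaryUnits, mem_stationaryUnits, Equiv.coe_mulRight, mul_inv, Units.val_mul,
        Units.val_mul, e1, e2]
      have : c * (h * (x * (1 + n * t)) -
          m * (((x⁻¹ : Rˣ) : R) * (1 - n * t + n ^ 2 * t ^ 2))) =
          c * (h * x - m * ((x⁻¹ : Rˣ) : R)) := by
        linear_combination (h * x * t + m * ((x⁻¹ : Rˣ) : R) * (t - n * t ^ 2)) * hcn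
      rw [this]
    · rw [← AddChar.map_add_eq_mul, Equiv.coe_mulRight, mul_inv, Units.val_mul, Units.val_mul, e1,
        e2]
      congr 1
      ring
  have hinner : ∀ x ∈ X, ‖∑ t, ψ (n * t * (h * x - m * ((x⁻¹ : Rˣ) : R)) +
      n ^ 2 * t ^ 2 * (m * ((x⁻¹ : Rˣ) : R)))‖ = √(Fintype.card R * A) := by
    intro x hx
    obtain ⟨w, hw⟩ := hann _ (mem_stationaryUnits.1 hx)
    have hunit : IsUnit (m * ((x⁻¹ : Rˣ) : R)) := by
      have hnil : IsNilpotent (-(n * w)) := ⟨3, by linear_combination -w ^ 3 * hn⟩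
      have := hnil.isUnit_add_left_of_commute (hh.mul x.isUnit) (Commute.all _ _)
      rwa [show h * x + -(n * w) = m * ((x⁻¹ : Rˣ) : R) by rw [← hw]; ring] at this
    rw [← Real.sqrt_sq (norm_nonneg _)]
    congr 1
    rw [← norm_sq_sum_quadratic hψ (n ^ 2) w (h2.mul hunit)]
    congr 2
    refine Finset.sum_congr rfl fun t _ => ?_
    rw [hw]
    congr 1
    ring
  have hcard : (0 : ℝ) < Fintype.card R := by exact_mod_cast Fintype.card_pos
  have hmain : ‖ringKloosterman ψ h m‖ * Fintype.card R ≤ X.card * √(Fintype.card R * A) := by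
    have : (Fintype.card R : ℂ) * ringKloosterman ψ h m = ∑ x ∈ X,
        ψ (h * x + m * ((x⁻¹ : Rˣ) : R)) * ∑ t, ψ (n * t * (h * x - m * ((x⁻¹ : Rˣ) : R)) +
          n ^ 2 * t ^ 2 * (m * ((x⁻¹ : Rˣ) : R))) := by
      simp_rw [Finset.mul_sum]
      rw [Finset.sum_comm, ← Finset.sum_congr rfl fun t _ => hshift t]
      simp
    have hnorm : ‖ringKloosterman ψ h m‖ * Fintype.card R =
        ‖(Fintype.card R : ℂ) * ringKloosterman ψ h m‖ := by
      rw [norm_mul, Complex.norm_natCast, mul_comm]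
    rw [hnorm, this]
    refine (norm_sum_le _ _).trans ?_
    rw [Finset.sum_congr rfl fun x hx => by
      rw [norm_mul, AddChar.norm_apply, one_mul, hinner x hx]]
    simp
  rw [Real.sqrt_mul hcard.le] at hmain
  have hs : (0 : ℝ) < √(Fintype.card R) := Real.sqrt_pos.2 hcard
  refine le_of_mul_le_mul_right ?_ hs
  rw [mul_assoc, Real.mul_self_sqrt hcard.le]
  linarith

theorem card_stationaryUnits_le {h m n n' : R} (hh : IsUnit h)
    (hdisj : ∀ x y : Rˣ, n * (((x : R) - y) * (x + y)) = 0 →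
      n' * ((x : R) - y) = 0 ∨ n' * ((x : R) + y) = 0) :
    (stationaryUnits h m n).card ≤ 2 * (Finset.univ.filter fun r : R => n' * r = 0).card := by
  rcases (stationaryUnits h m n).eq_empty_or_nonempty with h0 | ⟨y, hy⟩
  · simp [h0]
  set A := Finset.univ.filter fun r : R => n' * r = 0 with hA
  have hmul : ∀ x ∈ stationaryUnits h m n, n * (h * x ^ 2 - m) = 0 := by
    intro x hx
    have := mem_stationaryUnits.1 hx
    linear_combination (x : R) * this + n * m * x.mul_inv
  have hsub : (stationaryUnits h m n).image (fun x : Rˣ => (x : R)) ⊆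
      A.image (fun r => y + r) ∪ A.image (fun r => -y + r) := by
    intro z hz
    obtain ⟨x, hx, rfl⟩ := Finset.mem_image.1 hz
    have h1 : n * (((x : R) - y) * (x + y)) = 0 := by
      rw [← hh.mul_right_eq_zero]
      linear_combination hmul x hx - hmul y hy
    rw [Finset.mem_union, Finset.mem_image, Finset.mem_image]
    rcases hdisj x y h1 with h2 | h2
    · exact Or.inl ⟨x - y, by simpa [hA] using h2, by ring⟩
    · exact Or.inr ⟨x + y, by simpa [hA] using h2, by ring⟩
  rw [← Finset.card_image_of_injective _ (Units.val_injective (α := R))]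
  refine (Finset.card_le_card hsub).trans ((Finset.card_union_le _ _).trans ?_)
  rw [two_mul]
  exact add_le_add Finset.card_image_le Finset.card_image_le

end FiniteRing

section PrimePower

variable {p a : ℕ} [Fact p.Prime]

theorem natCast_pow_mul_eq_zero_iff {e : ℕ} (he : e ≤ a) (y : ZMod (p ^ a)) :
    (p : ZMod (p ^ a)) ^ e * y = 0 ↔ p ^ (a - e) ∣ y.val := by
  have hp : 0 < p ^ e := pow_pos (Fact.out : p.Prime).pos e
  conv_lhs => rw [← ZMod.natCast_zmod_val y, ← Nat.cast_pow, ← Nat.cast_mul,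
    ZMod.natCast_eq_zero_iff]
  rw [← Nat.mul_dvd_mul_iff_left (b := p ^ (a - e)) hp, ← pow_add, Nat.add_sub_cancel' he]

theorem dvd_of_natCast_pow_mul_eq_zero {e : ℕ} (he : e ≤ a) {y : ZMod (p ^ a)}
    (hy : (p : ZMod (p ^ a)) ^ e * y = 0) : (p : ZMod (p ^ a)) ^ (a - e) ∣ y := by
  obtain ⟨c, hc⟩ := (natCast_pow_mul_eq_zero_iff he y).1 hy
  exact ⟨c, by rw [← ZMod.natCast_zmod_val y, hc]; push_cast; rfl⟩

theorem card_natCast_pow_mul_eq_zero_le {e : ℕ} (he : e ≤ a) :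
    (Finset.univ.filter fun y : ZMod (p ^ a) => (p : ZMod (p ^ a)) ^ e * y = 0).card ≤ p ^ e := by
  calc _ ≤ (Finset.range (p ^ e)).card := by
        refine Finset.card_le_card_of_injOn (fun y => y.val / p ^ (a - e)) ?_ ?_
        · intro y _
          simp only [Finset.coe_range, Set.mem_Iio]
          refine Nat.div_lt_of_lt_mul ?_
          rw [← pow_add, Nat.sub_add_cancel he]
          exact y.val_lt
        · intro y hy z hz hyz
          simp only [Finset.coe_filter, Finset.mem_univ, true_and, Set.mem_ofPred_eq,
            natCast_pow_mul_eq_zero_iff he] at hy hz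
          exact ZMod.val_injective _ ((Nat.div_left_inj hy hz).1 hyz)
    _ = p ^ e := Finset.card_range _

theorem natCast_dvd_of_not_isUnit {y : ZMod (p ^ a)} (hy : ¬ IsUnit y) :
    (p : ZMod (p ^ a)) ∣ y := by
  rw [← ZMod.natCast_zmod_val y, ZMod.isUnit_iff_coprime] at hy
  have : p ∣ y.val := by
    by_contra h
    exact hy (((Fact.out : p.Prime).coprime_iff_not_dvd.2 h).symm.pow_right a)
  obtain ⟨c, hc⟩ := this
  exact ⟨c, by rw [← ZMod.natCast_zmod_val y, hc]; push_cast; rfl⟩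

omit [Fact p.Prime] in
theorem isNilpotent_natCast : IsNilpotent (p : ZMod (p ^ a)) :=
  ⟨a, by rw [← Nat.cast_pow, ZMod.natCast_self]⟩

theorem isUnit_or_isUnit_of_sub {x y : ZMod (p ^ a)} (h : IsUnit (x - y)) :
    IsUnit x ∨ IsUnit y := by
  by_contra! hxy
  have hd := dvd_sub (natCast_dvd_of_not_isUnit hxy.1) (natCast_dvd_of_not_isUnit hxy.2)
  rcases subsingleton_or_nontrivial (ZMod (p ^ a)) with hs | hn
  · exact hxy.1 (isUnit_of_subsingleton x)
  · exact isNilpotent_natCast.not_isUnit (isUnit_of_dvd_unit hd h)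

theorem card_stationaryUnits_zmod_le_of_ne_two (hp : p ≠ 2) {e : ℕ} (he : e ≤ a)
    {h m : ZMod (p ^ a)} (hh : IsUnit h) :
    (stationaryUnits h m ((p : ZMod (p ^ a)) ^ e)).card ≤ 2 * p ^ e := by
  have h2 : IsUnit (2 : ZMod (p ^ a)) := by
    rw [← Nat.cast_ofNat, ZMod.isUnit_iff_coprime]
    exact (((Nat.coprime_primes Nat.prime_two Fact.out).2 hp.symm).pow_right a)
  refine (card_stationaryUnits_le hh (n' := (p : ZMod (p ^ a)) ^ e) fun x y hxy => ?_).trans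
    (Nat.mul_le_mul_left 2 (card_natCast_pow_mul_eq_zero_le he))
  have hu : IsUnit (((x : ZMod (p ^ a)) + y) - (x - y)) := by
    rw [show ((x : ZMod (p ^ a)) + y) - (x - y) = 2 * y by ring]
    exact h2.mul y.isUnit
  rcases isUnit_or_isUnit_of_sub hu with h' | h'
  · left
    rwa [← mul_assoc, h'.mul_left_eq_zero] at hxy
  · right
    rwa [mul_left_comm, h'.mul_right_eq_zero] at hxy

theorem card_stationaryUnits_zmod_two_pow_le {a e : ℕ} (he : e + 1 ≤ a) {h m : ZMod (2 ^ a)}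
    (hh : IsUnit h) :
    (stationaryUnits h m ((2 : ZMod (2 ^ a)) ^ e)).card ≤ 2 * 2 ^ (e + 1) := by
  have hcard := card_natCast_pow_mul_eq_zero_le (p := 2) he
  rw [Nat.cast_ofNat] at hcard
  refine (card_stationaryUnits_le hh (n' := (2 : ZMod (2 ^ a)) ^ (e + 1)) fun x y hxy => ?_).trans
    (Nat.mul_le_mul_left 2 hcard)
  have hodd : ∀ z : (ZMod (2 ^ a))ˣ, (2 : ZMod (2 ^ a)) ∣ z - 1 := by
    intro z
    have hz := (ZMod.isUnit_iff_coprime (z : ZMod (2 ^ a)).val (2 ^ a)).1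
      (by rw [ZMod.natCast_zmod_val]; exact z.isUnit)
    have hz2 : Odd (z : ZMod (2 ^ a)).val :=
      Nat.coprime_two_right.1 (Nat.Coprime.coprime_dvd_right (dvd_pow_self 2 (by omega)) hz)
    obtain ⟨c, hc⟩ := hz2
    refine ⟨c, ?_⟩
    rw [← ZMod.natCast_zmod_val (z : ZMod (2 ^ a)), hc]
    push_cast
    ring
  obtain ⟨d, hd⟩ : (2 : ZMod (2 ^ a)) ∣ x - y := by
    have := dvd_sub (hodd x) (hodd y)
    rwa [sub_sub_sub_cancel_right] at this
  have hx : (x : ZMod (2 ^ a)) = 2 * d + y := by rw [← hd]; ring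
  have h' : IsUnit (d + y) ∨ IsUnit d :=
    isUnit_or_isUnit_of_sub (p := 2) (by rw [add_sub_cancel_left]; exact y.isUnit)
  rw [hx] at hxy ⊢
  rcases h' with h' | h'
  · left
    rw [← h'.mul_right_eq_zero]
    linear_combination hxy
  · right
    rw [← h'.mul_right_eq_zero]
    linear_combination hxy

end PrimePower

section PrimePowerBound

theorem card_divisors_prime_pow {p : ℕ} (hp : p.Prime) (a : ℕ) :
    (p ^ a).divisors.card = a + 1 := by
  rw [Nat.divisors_prime_pow hp, Finset.card_map, Finset.card_range]

theorem norm_ringKloosterman_prime_pow_le_of_ne_two {p a : ℕ} [Fact p.Prime] (hp : p ≠ 2)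
    (ha : 2 ≤ a) {ψ : AddChar (ZMod (p ^ a)) ℂ} (hψ : ψ.IsPrimitive) {h m : ZMod (p ^ a)}
    (hh : IsUnit h) : ‖ringKloosterman ψ h m‖ ≤ 2 * √((p : ℝ) ^ a) := by
  have hzero : ∀ e, a ≤ e → (p : ZMod (p ^ a)) ^ e = 0 := fun e he =>
    pow_eq_zero_of_le he (by rw [← Nat.cast_pow, ZMod.natCast_self])
  rcases a.even_or_odd' with ⟨b, hb | hb⟩
  · have h1 := norm_ringKloosterman_le_card_stationaryUnits hψ h m (n := (p : ZMod (p ^ a)) ^ b)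
      (by rw [← pow_mul]; exact hzero _ (by omega))
    have h2 := card_stationaryUnits_zmod_le_of_ne_two hp (e := b) (by omega) hh (m := m)
    have h3 : √((p : ℝ) ^ a) = p ^ b := by
      rw [hb, mul_comm, pow_mul, Real.sqrt_sq (by positivity)]
    rw [h3]
    exact h1.trans (by exact_mod_cast h2)
  · have h1 := norm_ringKloosterman_mul_sqrt_le hψ hh (m := m) (n := (p : ZMod (p ^ a)) ^ b)
      (c := (p : ZMod (p ^ a)) ^ (b + 1)) ?_ (by rw [← pow_mul]; exact hzero _ (by omega))
      (by rw [← pow_mul]; exact hzero _ (by omega)) (by rw [← pow_add]; exact hzero _ (by omega))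
      (fun y hy => by
        have := dvd_of_natCast_pow_mul_eq_zero (by omega) hy
        rwa [show a - (b + 1) = b by omega] at this)
    · have h2 := card_stationaryUnits_zmod_le_of_ne_two hp (e := b + 1) (by omega) hh (m := m)
      have h3 := card_natCast_pow_mul_eq_zero_le (p := p) (a := a) (e := b * 2) (by omega)
      rw [← pow_mul, ZMod.card, Nat.cast_pow] at h1
      have h4 : (0 : ℝ) < √((p : ℝ) ^ a) :=
        Real.sqrt_pos.2 (pow_pos (by exact_mod_cast (Fact.out : p.Prime).pos) _)
      have h5 : √((Finset.univ.filter fun r : ZMod (p ^ a) =>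
          (p : ZMod (p ^ a)) ^ (b * 2) * r = 0).card : ℝ) ≤ p ^ b := by
        rw [Real.sqrt_le_left (by positivity), ← pow_mul]
        exact_mod_cast h3
      refine le_of_mul_le_mul_right (h1.trans ?_) h4
      rw [mul_assoc, Real.mul_self_sqrt (by positivity)]
      calc _ ≤ (2 * (p : ℝ) ^ (b + 1)) * p ^ b :=
            mul_le_mul (by exact_mod_cast h2) h5 (Real.sqrt_nonneg _) (by positivity)
        _ = 2 * (p : ℝ) ^ a := by rw [hb]; ring
    · rw [← Nat.cast_ofNat, ZMod.isUnit_iff_coprime]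
      exact (((Nat.coprime_primes Nat.prime_two Fact.out).2 hp.symm).pow_right a)

theorem norm_ringKloosterman_two_pow_le {a : ℕ} (ha : a ≠ 0) {ψ : AddChar (ZMod (2 ^ a)) ℂ}
    (hψ : ψ.IsPrimitive) {h m : ZMod (2 ^ a)} (hh : IsUnit h) :
    ‖ringKloosterman ψ h m‖ ≤ (a + 1) * √((2 : ℝ) ^ a) := by
  have hzero : ∀ e, a ≤ e → (2 : ZMod (2 ^ a)) ^ e = 0 := fun e he =>
    pow_eq_zero_of_le he (by exact_mod_cast ZMod.natCast_self (2 ^ a))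
  have htriv : ‖ringKloosterman ψ h m‖ ≤ 2 ^ (a - 1) := by
    refine (norm_ringKloosterman_le_card_units ψ h m).trans_eq ?_
    rw [ZMod.card_units_eq_totient, Nat.totient_prime_pow Nat.prime_two (Nat.pos_of_ne_zero ha)]
    simp
  have hgen : ∀ e, a ≤ 2 * e → e + 1 ≤ a → ‖ringKloosterman ψ h m‖ ≤ 4 * 2 ^ e := by
    intro e he he'
    have h1 := norm_ringKloosterman_le_card_stationaryUnits hψ h m (n := (2 : ZMod (2 ^ a)) ^ e)
      (by rw [← pow_mul]; exact hzero _ (by omega))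
    have h2 := card_stationaryUnits_zmod_two_pow_le he' hh (m := m)
    refine h1.trans ?_
    have : 2 * 2 ^ (e + 1) = 4 * 2 ^ e := by ring
    rw [this] at h2
    exact_mod_cast h2
  rcases a.even_or_odd' with ⟨b, hb | hb⟩
  · have h3 : √((2 : ℝ) ^ a) = 2 ^ b := by
      rw [hb, mul_comm, pow_mul, Real.sqrt_sq (by positivity)]
    rw [h3]
    by_cases hb1 : b = 1
    · subst hb1 hb
      norm_num at htriv ⊢
      linarith
    · refine (hgen b (by omega) (by omega)).trans ?_
      have : (3 : ℝ) ≤ a := by exact_mod_cast (by omega : 3 ≤ a)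
      gcongr
      linarith
  · have hs2 : (7 / 5 : ℝ) ≤ √2 := Real.le_sqrt_of_sq_le (by norm_num)
    have h3 : √((2 : ℝ) ^ a) = 2 ^ b * √2 := by
      rw [hb, pow_succ, mul_comm 2 b, pow_mul, Real.sqrt_mul (by positivity),
        Real.sqrt_sq (by positivity)]
    rw [h3]
    have hb2 : (0 : ℝ) < 2 ^ b := by positivity
    have ha' : (a : ℝ) = 2 * b + 1 := by exact_mod_cast hb
    by_cases hb1 : b ≤ 1
    · interval_cases b
      · subst hb
        norm_num at htriv ⊢
        linarith
      · subst hb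
        norm_num at htriv ⊢
        linarith
    · refine (hgen (b + 1) (by omega) (by omega)).trans ?_
      have hb' : (2 : ℝ) ≤ b := by exact_mod_cast (by omega : 2 ≤ b)
      have h8 : (8 : ℝ) ≤ (a + 1) * √2 := by
        rw [ha']
        nlinarith
      calc (4 : ℝ) * 2 ^ (b + 1) = 8 * 2 ^ b := by ring
        _ ≤ ((a + 1) * √2) * 2 ^ b := by gcongr
        _ = _ := by ring

theorem norm_ringKloosterman_prime_le {p : ℕ} [Fact p.Prime] (hp : p ≠ 2)
    {ψ : AddChar (ZMod p) ℂ} (hψ : ψ.IsPrimitive) {h m : ZMod p} (hh : IsUnit h) :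
    ‖ringKloosterman ψ h m‖ ≤ 2 * √p := by
  have hψ1 : ψ ≠ 1 := by simpa using hψ one_ne_zero
  have hh0 := hh.ne_zero
  by_cases hm : m = 0
  · have h1 : ringKloosterman ψ h m = -1 := by
      rw [ringKloosterman_eq_sum_ite, ← sub_eq_zero, sub_neg_eq_add]
      refine Eq.trans ?_ (AddChar.sum_eq_zero_of_ne_one (hψ hh0))
      calc _ = ∑ x : ZMod p, ((if x = 0 then 0 else ψ (h * x + m * x⁻¹)) +
            if x = 0 then 1 else 0) := by
            rw [Finset.sum_add_distrib]
            simp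
        _ = _ := by
            refine Finset.sum_congr rfl fun x _ => ?_
            rw [AddChar.mulShift_apply, hm]
            split_ifs with hx <;> simp [hx]
    rw [h1, norm_neg, norm_one]
    have : (1 : ℝ) ≤ √p := Real.one_le_sqrt.2 (by exact_mod_cast (Fact.out : p.Prime).one_le)
    linarith
  · exact norm_ringKloosterman_zmod_le hp hψ1 hh0 hm

end PrimePowerBound

section Multiplicativity

/-- The bound with the number of divisors, for all primitive characters modulo `k`. -/
def KloostermanBound (k : ℕ) : Prop :=
  ∀ [NeZero k] (ψ : AddChar (ZMod k) ℂ), ψ.IsPrimitive → ∀ h m : ZMod k, IsUnit h →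
    ‖ringKloosterman ψ h m‖ ≤ k.divisors.card * √k

theorem kloostermanBound_prime_pow {p a : ℕ} (hp : p.Prime) (ha : 0 < a) :
    KloostermanBound (p ^ a) := by
  have : Fact p.Prime := ⟨hp⟩
  rcases eq_or_ne p 2 with hp2 | hp2
  · subst hp2
    intro _ ψ hψ h m hh
    rw [card_divisors_prime_pow hp]
    convert norm_ringKloosterman_two_pow_le ha.ne' hψ hh (m := m) using 2
    · push_cast; rfl
    · push_cast; rfl
  rcases eq_or_ne a 1 with ha1 | ha1
  · subst ha1
    rw [pow_one]
    intro _ ψ hψ h m hh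
    convert norm_ringKloosterman_prime_le hp2 hψ hh (m := m) using 2
    rw [hp.divisors, Finset.card_pair hp.one_lt.ne]
    norm_num
  · intro _ ψ hψ h m hh
    rw [card_divisors_prime_pow hp, Nat.cast_pow]
    refine (norm_ringKloosterman_prime_pow_le_of_ne_two hp2 (by omega) hψ hh).trans ?_
    gcongr
    exact_mod_cast (by omega : 2 ≤ a + 1)

theorem ringKloosterman_comp_ringEquiv {R S : Type*} [CommRing R] [CommRing S] [Fintype Rˣ]
    [Fintype Sˣ] (e : R ≃+* S) (ψ : AddChar S ℂ) (h m : R) :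
    ringKloosterman (ψ.compAddMonoidHom (e : R →+ S)) h m = ringKloosterman ψ (e h) (e m) := by
  refine Fintype.sum_equiv (Units.mapEquiv e.toMulEquiv).toEquiv _ _ fun x => ?_
  rw [AddChar.compAddMonoidHom_apply]
  congr 1
  rw [AddMonoidHom.coe_coe, map_add, map_mul, map_mul]
  rfl

theorem ringKloosterman_prod {R S : Type*} [CommRing R] [CommRing S] [Fintype Rˣ]
    [Fintype Sˣ] [Fintype (R × S)ˣ] (ψ : AddChar (R × S) ℂ) (h m : R × S) :
    ringKloosterman ψ h m =
      ringKloosterman (ψ.compAddMonoidHom (AddMonoidHom.inl R S)) h.1 m.1 *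
        ringKloosterman (ψ.compAddMonoidHom (AddMonoidHom.inr R S)) h.2 m.2 := by
  rw [ringKloosterman, ringKloosterman, ringKloosterman, Finset.sum_mul_sum,
    ← Fintype.sum_prod_type']
  refine Fintype.sum_equiv MulEquiv.prodUnits.toEquiv _ _ fun x => ?_
  rw [AddChar.compAddMonoidHom_apply, AddChar.compAddMonoidHom_apply, ← AddChar.map_add_eq_mul]
  congr 1
  ext <;> simp [MulEquiv.prodUnits]

theorem KloostermanBound.mul {a b : ℕ} (hab : a.Coprime b) (ha : KloostermanBound a)
    (hb : KloostermanBound b) : KloostermanBound (a * b) := by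
  intro _ ψ hψ h m hh
  have ha0 : NeZero a := ⟨left_ne_zero_of_mul (NeZero.ne (a * b))⟩
  have hb0 : NeZero b := ⟨right_ne_zero_of_mul (NeZero.ne (a * b))⟩
  let e := ZMod.chineseRemainder hab
  let φ : AddChar (ZMod a × ZMod b) ℂ := ψ.compAddMonoidHom (e.symm : _ →+ ZMod (a * b))
  have hφ : φ.IsPrimitive := by
    intro c hc h1
    refine hψ (a := e.symm c) (by simpa using hc) ?_
    ext x
    have := DFunLike.congr_fun h1 (e x)
    simpa [φ, AddChar.mulShift_apply, AddChar.compAddMonoidHom_apply] using this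
  have h1 : (φ.compAddMonoidHom (AddMonoidHom.inl (ZMod a) (ZMod b))).IsPrimitive := by
    intro c hc h1
    refine hφ (a := (c, 0)) (by simpa [Prod.ext_iff] using hc) ?_
    ext x
    have := DFunLike.congr_fun h1 x.1
    simpa [AddChar.mulShift_apply, AddChar.compAddMonoidHom_apply, Prod.mul_def] using this
  have h2 : (φ.compAddMonoidHom (AddMonoidHom.inr (ZMod a) (ZMod b))).IsPrimitive := by
    intro c hc h1
    refine hφ (a := (0, c)) (by simpa [Prod.ext_iff] using hc) ?_
    ext x
    have := DFunLike.congr_fun h1 x.2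
    simpa [AddChar.mulShift_apply, AddChar.compAddMonoidHom_apply, Prod.mul_def] using this
  have hψφ : ψ = φ.compAddMonoidHom (e : ZMod (a * b) →+ _) := by
    ext x
    rw [AddChar.compAddMonoidHom_apply, AddChar.compAddMonoidHom_apply, AddMonoidHom.coe_coe,
      AddMonoidHom.coe_coe, e.symm_apply_apply]
  have hu := Prod.isUnit_iff.1 (hh.map e)
  rw [hψφ, ringKloosterman_comp_ringEquiv, ringKloosterman_prod, norm_mul,
    hab.card_divisors_mul, Nat.cast_mul, Nat.cast_mul, Real.sqrt_mul (Nat.cast_nonneg a)]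
  calc _ ≤ (a.divisors.card * √a) * (b.divisors.card * √b) :=
        mul_le_mul (ha _ h1 _ _ hu.1) (hb _ h2 _ _ hu.2) (norm_nonneg _)
          (mul_nonneg (Nat.cast_nonneg _) (Real.sqrt_nonneg _))
    _ = _ := by ring

theorem kloostermanBound (k : ℕ) : KloostermanBound k := by
  induction k using Nat.recOnPosPrimePosCoprime with
  | prime_pow p n hp hn => exact kloostermanBound_prime_pow hp hn
  | zero =>
    intro h0
    exact absurd rfl h0.out
  | one =>
    intro _ ψ _ h m _
    refine (norm_ringKloosterman_le_card_units ψ h m).trans ?_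
    rw [ZMod.card_units_eq_totient]
    simp
  | coprime a b _ _ hab iha ihb => exact iha.mul hab ihb

theorem kloosterman_eq_ringKloosterman (h m : ℤ) (k : ℕ) [NeZero k] :
    kloosterman h m k = ringKloosterman ZMod.stdAddChar (h : ZMod k) (m : ZMod k) := by
  refine Finset.sum_congr rfl fun x _ => ?_
  have hcast : (h : ZMod k) * (x : ZMod k) + m * ((x⁻¹ : (ZMod k)ˣ) : ZMod k) =
      ((h * ((x : ZMod k).val : ℤ) + m * (((x⁻¹ : (ZMod k)ˣ) : ZMod k).val : ℤ) : ℤ) : ZMod k) := by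
    push_cast
    rw [ZMod.natCast_zmod_val, ZMod.natCast_zmod_val]
  rw [hcast, ZMod.stdAddChar_coe]
  push_cast
  congr 1
  ring

end Multiplicativity

/-- Weil's bound in the coprime case: `|S(h,m;k)| ≤ d(k) √k`. -/
theorem stmt_7 (h m : ℤ) (k : ℕ) [NeZero k] (hcop : Int.gcd h (k : ℤ) = 1) :
    ‖kloosterman h m k‖ ≤ (k.divisors.card : ℝ) * Real.sqrt k := by
  rw [kloosterman_eq_ringKloosterman]
  refine kloostermanBound k _ (ZMod.isPrimitive_stdAddChar k) _ _ ?_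
  exact (ZMod.coe_int_isUnit_iff_isCoprime h k).2 (Int.isCoprime_iff_gcd_eq_one.2 hcop).symm
end

section
/- Fix real numbers α, β, γ with α + β + γ = 0. Define G(s) as the quotient Γ((1-s+α)/2)Γ((1-s+β)/2)Γ((1-s+γ)/2) / (Γ((s-α)/2)Γ((s-β)/2)Γ((s-γ)/2)). Then for s in a fixed vertical strip A ≤ Re(s) ≤ B with |Im(s)| sufficiently large, G(s) = 3^{3s - 3/2} · Γ((1-3s)/2)/Γ((3s-2)/2) · (1 + O(|s|^{-1})), with implied constant depending only on α, β, γ, A, B. -/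
open Real Complex

/-- The main term of Stirling's expansion of `log Γ`, without its constant. -/
noncomputable def stirlingExponent (z : ℂ) : ℂ := (z - 1 / 2) * Complex.log z - z

theorem log_add_ofReal_eq {z : ℂ} {a : ℝ} (hz : z.im ≠ 0) (ha : |a| < ‖z‖) :
    Complex.log (z + a) = Complex.log z + Complex.log (1 + a / z) := by
  have hz0 : z ≠ 0 := fun h => hz (by simp [h])
  have hza : z + a ≠ 0 := fun h => hz (by simpa using congrArg Complex.im h)
  have hw : ‖(a : ℂ) / z‖ < 1 := by
    rw [norm_div, Complex.norm_real, Real.norm_eq_abs, div_lt_one (norm_pos_iff.2 hz0)]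
    exact ha
  have hre : 0 < (1 + (a : ℂ) / z).re := by
    have h := neg_le_of_abs_le (Complex.abs_re_le_norm ((a : ℂ) / z))
    rw [Complex.add_re, Complex.one_re]
    linarith
  have hne : 1 + (a : ℂ) / z ≠ 0 := fun h => by simp [h] at hre
  have harg := abs_lt.1 (Complex.abs_arg_lt_pi_div_two_iff.2 (Or.inl hre))
  have hexp : Complex.exp (Complex.log (z + a)) =
      Complex.exp (Complex.log z + Complex.log (1 + a / z)) := by
    rw [Complex.exp_add, Complex.exp_log hza, Complex.exp_log hz0, Complex.exp_log hne]
    field_simp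
  obtain ⟨n, hn⟩ := Complex.exp_eq_exp_iff_exists_int.1 hexp
  have him := congrArg Complex.im hn
  simp only [Complex.add_im, Complex.log_im] at him
  have h2 : ((n : ℂ) * (2 * π * I)).im = n * (2 * π) := by simp
  rw [h2] at him
  have hdiff : |Complex.arg (z + a) - Complex.arg z| < π := by
    have h1 := Complex.arg_le_pi z
    have h3 := Complex.neg_pi_lt_arg z
    have h4 := Complex.arg_le_pi (z + a)
    have h5 := Complex.neg_pi_lt_arg (z + a)
    have hia : (z + a).im = z.im := by simp
    rcases lt_or_gt_of_ne hz with h | h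
    · have h6 := Complex.arg_neg_iff.2 h
      have h7 := Complex.arg_neg_iff.2 (hia ▸ h : (z + a).im < 0)
      rw [abs_lt]; constructor <;> linarith
    · have h6 := Complex.arg_nonneg_iff.2 h.le
      have h7 := Complex.arg_nonneg_iff.2 (hia ▸ h.le : 0 ≤ (z + a).im)
      have h8 : Complex.arg z < π := Complex.arg_lt_pi_iff.2 (Or.inr hz)
      have h9 : Complex.arg (z + a) < π := Complex.arg_lt_pi_iff.2 (Or.inr (hia ▸ hz))
      rw [abs_lt]; constructor <;> linarith
  rw [abs_lt] at hdiff
  have hpi := Real.pi_pos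
  have hn0 : n = 0 := by
    have h1 : (n : ℝ) < 1 := by nlinarith
    have h3 : (-1 : ℝ) < n := by nlinarith
    have h1' : n < 1 := by exact_mod_cast h1
    have h3' : -1 < n := by exact_mod_cast h3
    omega
  simpa [hn0] using hn

theorem norm_stirlingExponent_add_one_sub_le {z : ℂ} (hz : z.im ≠ 0) (h2 : 2 ≤ ‖z‖) :
    ‖stirlingExponent (z + 1) - stirlingExponent z - Complex.log z‖ ≤ 2 / ‖z‖ ^ 2 := by
  have hz0 : z ≠ 0 := fun h => hz (by simp [h])
  have hlog := log_add_ofReal_eq (a := 1) hz (by rw [abs_one]; linarith)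
  rw [Complex.ofReal_one] at hlog
  set w : ℂ := 1 / z with hw
  have hwn : ‖w‖ = 1 / ‖z‖ := by simp [hw]
  have hwle : ‖w‖ ≤ 1 / 2 := by rw [hwn]; gcongr
  have hr := Complex.norm_log_sub_logTaylor_le 2 (z := w) (by linarith)
  set r := Complex.log (1 + w) - Complex.logTaylor (2 + 1) w with hr'
  have htay : Complex.log (1 + w) = w - w ^ 2 / 2 + r := by
    rw [hr']
    simp [Complex.logTaylor_succ, Complex.logTaylor_zero]
    ring
  have hrn : ‖r‖ ≤ ‖w‖ ^ 3 := by
    refine hr.trans ?_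
    have h1 : (1 - ‖w‖)⁻¹ ≤ 2 := by
      rw [inv_le_comm₀ (by linarith) (by norm_num)]; linarith
    have h3 : ‖w‖ ^ (2 + 1) * (1 - ‖w‖)⁻¹ ≤ ‖w‖ ^ 3 * 2 := by gcongr
    have h4 : 0 ≤ ‖w‖ ^ 3 := by positivity
    norm_num at h3 ⊢
    linarith
  have key : stirlingExponent (z + 1) - stirlingExponent z - Complex.log z =
      -w ^ 2 / 4 + (z + 1 / 2) * r := by
    have hzw : z = 1 / w := by simp [hw]
    have hw0 : w ≠ 0 := by simp [hw, hz0]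
    simp only [stirlingExponent]
    rw [hlog, htay]
    generalize Complex.log z = L
    rw [hzw]
    field_simp
    ring
  rw [key]
  have hz1 : ‖z + 1 / 2‖ ≤ ‖z‖ + 1 / 2 := (norm_add_le _ _).trans (by norm_num)
  calc ‖-w ^ 2 / 4 + (z + 1 / 2) * r‖ ≤ ‖w‖ ^ 2 / 4 + (‖z‖ + 1 / 2) * ‖w‖ ^ 3 := by
        refine (norm_add_le _ _).trans ?_
        rw [norm_mul]
        gcongr
        simp
    _ ≤ 2 / ‖z‖ ^ 2 := by
        rw [hwn]
        have : 0 < ‖z‖ := by linarith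
        rw [div_pow, div_pow, ← sub_nonneg]
        field_simp
        nlinarith

theorem tendsto_Gamma_add_div_exp_stirlingExponent {z : ℂ} (hz : z.im ≠ 0) :
    Filter.Tendsto
      (fun n : ℕ => Complex.Gamma (z + (n + 1 : ℕ)) /
        Complex.exp (stirlingExponent (z + (n + 1 : ℕ))))
      Filter.atTop (nhds ((√2 * √π : ℝ) : ℂ)) := by
  have hzn : ∀ m : ℕ, z ≠ -m := fun m h => hz (by simp [h])
  have hG : Complex.Gamma z ≠ 0 := Complex.Gamma_ne_zero hzn
  set L : ℕ → ℂ := fun n => Complex.log (1 + (z + 1) / n) with hL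
  have hnL : Filter.Tendsto (fun n : ℕ => n * L n) Filter.atTop (nhds (z + 1)) := by
    refine Complex.tendsto_nat_mul_log_one_add_of_tendsto ?_
    refine tendsto_const_nhds.congr' ?_
    filter_upwards [Filter.eventually_gt_atTop 0] with n hn
    have : (n : ℂ) ≠ 0 := by exact_mod_cast hn.ne'
    field_simp
  have hL0 : Filter.Tendsto L Filter.atTop (nhds 0) := by
    have h := (tendsto_inv_atTop_nhds_zero_nat (𝕜 := ℂ)).mul hnL
    rw [zero_mul] at h
    refine h.congr' ?_
    filter_upwards [Filter.eventually_gt_atTop 0] with n hn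
    have : (n : ℂ) ≠ 0 := by exact_mod_cast hn.ne'
    field_simp
  have hexp : Filter.Tendsto
      (fun n : ℕ => Complex.exp (z + 1 - (n * L n + (z + 1 / 2) * L n))) Filter.atTop
      (nhds 1) := by
    have h := (tendsto_const_nhds (x := z + 1)).sub (hnL.add (hL0.const_mul (z + 1 / 2)))
    have h' := (Complex.continuous_exp.tendsto _).comp h
    simpa [Function.comp_def] using h'
  have hS : Filter.Tendsto (fun n : ℕ => ((√2 * Stirling.stirlingSeq n : ℝ) : ℂ)) Filter.atTop
      (nhds ((√2 * √π : ℝ) : ℂ)) :=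
    (Complex.continuous_ofReal.tendsto _).comp
      (Stirling.tendsto_stirlingSeq_sqrt_pi.const_mul (√2))
  have hGs : Filter.Tendsto (fun n : ℕ => Complex.Gamma z / Complex.GammaSeq z n) Filter.atTop
      (nhds 1) := by
    have h := (tendsto_const_nhds (x := Complex.Gamma z)).div (Complex.GammaSeq_tendsto_Gamma z) hG
    rwa [div_self hG] at h
  have hlim := (hGs.mul hS).mul hexp
  rw [one_mul, mul_one] at hlim
  refine hlim.congr' ?_
  filter_upwards [Filter.eventually_gt_atTop 0] with n hn
  have hn0 : (n : ℂ) ≠ 0 := by exact_mod_cast hn.ne'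
  have hnR : (0 : ℝ) < n := by exact_mod_cast hn
  have hprod : ∀ m : ℕ, Complex.Gamma (z + m) =
      (∏ j ∈ Finset.range m, (z + j)) * Complex.Gamma z := by
    intro m
    induction m with
    | zero => simp
    | succ m ih =>
      have hm : z + m ≠ 0 := fun h => hzn m (eq_neg_of_add_eq_zero_left h)
      rw [Finset.prod_range_succ, Nat.cast_succ, ← add_assoc, Complex.Gamma_add_one _ hm, ih]
      ring
  have hP : (∏ j ∈ Finset.range (n + 1), (z + (j : ℂ))) ≠ 0 :=
    Finset.prod_ne_zero_iff.2 fun j _ h => hzn j (eq_neg_of_add_eq_zero_left h)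
  have hne : 1 + (z + 1) / (n : ℂ) ≠ 0 := by
    intro h
    have h1 : (n : ℂ) + z + 1 = 0 := by
      field_simp at h
      linear_combination h
    exact hz (by simpa using congrArg Complex.im h1)
  have hlog : Complex.log (z + (n + 1 : ℕ)) = Real.log n + L n := by
    rw [hL, ← Complex.log_ofReal_mul hnR hne]
    congr 1
    push_cast
    field_simp
    ring
  have hfac : ((n.factorial : ℕ) : ℂ) = ((√2 * Stirling.stirlingSeq n : ℝ) : ℂ) *
      Complex.exp ((n + 1 / 2) * Real.log n - n) := by
    have h : (n.factorial : ℝ) = (√2 * Stirling.stirlingSeq n) *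
        Real.exp ((n + 1 / 2) * Real.log n - n) := by
      have h1 : Real.exp ((n + 1 / 2) * Real.log n - n) = √n * (n / Real.exp 1) ^ n := by
        rw [Real.sqrt_eq_rpow, Real.rpow_def_of_pos hnR, div_pow, ← Real.exp_nat_mul,
          ← Real.rpow_natCast, Real.rpow_def_of_pos hnR, ← Real.exp_sub, ← Real.exp_add]
        congr 1
        ring
      rw [h1, Stirling.stirlingSeq, Real.sqrt_mul (by norm_num)]
      have : √(n : ℝ) ≠ 0 := (Real.sqrt_pos.2 hnR).ne'
      field_simp
    have h' := congrArg (fun x : ℝ => (x : ℂ)) h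
    push_cast at h' ⊢
    exact h'
  rw [hprod, Complex.GammaSeq, Complex.cpow_def_of_ne_zero hn0, hfac, stirlingExponent, hlog,
    Complex.natCast_log]
  have hs : ((√2 * Stirling.stirlingSeq n : ℝ) : ℂ) ≠ 0 := by
    intro h
    rw [h, zero_mul] at hfac
    exact_mod_cast n.factorial_ne_zero (by exact_mod_cast hfac)
  rw [eq_div_iff (Complex.exp_ne_zero _)]
  generalize ((√2 * Stirling.stirlingSeq n : ℝ) : ℂ) = c at hs ⊢
  have hcomb : Complex.exp (z + 1 - (n * L n + (z + 1 / 2) * L n)) *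
      Complex.exp ((z + (n + 1 : ℕ) - 1 / 2) * (Complex.log n + L n) - (z + (n + 1 : ℕ))) =
      Complex.exp (Complex.log n * z) * Complex.exp ((n + 1 / 2) * Complex.log n - n) := by
    rw [← Complex.exp_add, ← Complex.exp_add]
    congr 1
    push_cast
    ring
  rw [mul_assoc, hcomb]
  field_simp

theorem sum_range_one_div_add_sq_le {Y : ℝ} (hY : 2 ≤ Y) (n : ℕ) :
    ∑ j ∈ Finset.range n, 1 / ((j : ℝ) + Y) ^ 2 ≤ 2 / Y := by
  have h : ∑ j ∈ Finset.range n, 1 / ((j : ℝ) + Y) ^ 2 ≤ 1 / (Y - 1) - 1 / (n + Y - 1) := by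
    induction n with
    | zero => simp
    | succ n ih =>
      rw [Finset.sum_range_succ]
      have hn : (0 : ℝ) ≤ n := n.cast_nonneg
      have hstep : 1 / ((n : ℝ) + Y) ^ 2 ≤ 1 / (n + Y - 1) - 1 / (n + Y) := by
        have h1 : 0 < (n : ℝ) + Y - 1 := by linarith
        have h2 : 0 < (n : ℝ) + Y := by linarith
        rw [div_sub_div _ _ h1.ne' h2.ne', div_le_div_iff₀ (by positivity) (by positivity)]
        nlinarith
      have hcast : ((n + 1 : ℕ) : ℝ) + Y - 1 = n + Y := by push_cast; ring
      rw [hcast]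
      linarith
  have hn : (0 : ℝ) ≤ n := n.cast_nonneg
  have h1 : 0 ≤ 1 / ((n : ℝ) + Y - 1) := by
    have : 0 < (n : ℝ) + Y - 1 := by linarith
    positivity
  have h2 : 1 / (Y - 1) ≤ 2 / Y := by
    rw [div_le_div_iff₀ (by linarith) (by linarith)]
    linarith
  linarith

/-- Stirling's formula on vertical strips. -/
theorem exists_Gamma_eq_exp_stirlingExponent {M : ℝ} {z : ℂ} (hre : |z.re| ≤ M)
    (him : 2 * M + 2 ≤ |z.im|) :
    ∃ e : ℂ, ‖e‖ ≤ 16 / |z.im| ∧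
      Complex.Gamma z = ((√2 * √π : ℝ) : ℂ) * Complex.exp (stirlingExponent z + e) := by
  set Y := |z.im| with hY
  have hM : 0 ≤ M := (abs_nonneg _).trans hre
  have hY2 : 2 ≤ Y := by linarith
  have hz : z.im ≠ 0 := by
    intro h
    rw [hY, h, abs_zero] at hY2
    norm_num at hY2
  have hzn : ∀ m : ℕ, z ≠ -m := fun m h => hz (by simp [h])
  have hG : Complex.Gamma z ≠ 0 := Complex.Gamma_ne_zero hzn
  set u : ℕ → ℂ := fun j =>
    stirlingExponent (z + j + 1) - stirlingExponent (z + j) - Complex.log (z + j) with hu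
  have hu_le : ∀ j : ℕ, ‖u j‖ ≤ 8 * (1 / ((j : ℝ) + Y) ^ 2) := by
    intro j
    have hj : (0 : ℝ) ≤ j := j.cast_nonneg
    have him' : (z + j).im = z.im := by simp
    have hYn : Y ≤ ‖z + j‖ := by
      rw [hY, ← him']
      exact Complex.abs_im_le_norm _
    refine (norm_stirlingExponent_add_one_sub_le (him'.symm ▸ hz) (hY2.trans hYn)).trans ?_
    have hsq : ((j : ℝ) + Y) ^ 2 / 4 ≤ ‖z + j‖ ^ 2 := by
      have h1 : ‖z + j‖ ^ 2 = (z.re + j) ^ 2 + Y ^ 2 := by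
        rw [Complex.sq_norm, Complex.normSq_apply, hY, sq_abs]
        simp
        ring
      have h2 : z.re ^ 2 ≤ M ^ 2 := sq_le_sq' (neg_le_of_abs_le hre) (le_of_abs_le hre)
      rw [h1]
      nlinarith [sq_nonneg (2 * z.re + j), sq_nonneg ((j : ℝ) - Y)]
    have hpos : 0 < ((j : ℝ) + Y) ^ 2 := by positivity
    calc 2 / ‖z + j‖ ^ 2 ≤ 2 / (((j : ℝ) + Y) ^ 2 / 4) := by gcongr
      _ = 8 * (1 / ((j : ℝ) + Y) ^ 2) := by field_simp; norm_num
  have hS : ∀ n : ℕ, ‖∑ j ∈ Finset.range n, u j‖ ≤ 16 / Y := by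
    intro n
    calc ‖∑ j ∈ Finset.range n, u j‖ ≤ ∑ j ∈ Finset.range n, 8 * (1 / ((j : ℝ) + Y) ^ 2) :=
          norm_sum_le_of_le _ fun j _ => hu_le j
      _ ≤ 8 * (2 / Y) := by
          rw [← Finset.mul_sum]
          gcongr
          exact sum_range_one_div_add_sq_le hY2 n
      _ = 16 / Y := by ring
  have hR : ∀ n : ℕ, Complex.Gamma (z + n) / Complex.exp (stirlingExponent (z + n)) =
      Complex.Gamma z / Complex.exp (stirlingExponent z) *
        Complex.exp (-∑ j ∈ Finset.range n, u j) := by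
    intro n
    induction n with
    | zero => simp
    | succ n ih =>
      have hn : z + n ≠ 0 := fun h => hzn n (eq_neg_of_add_eq_zero_left h)
      have hE : stirlingExponent (z + (n + 1 : ℕ)) =
          stirlingExponent (z + n) + Complex.log (z + n) + u n := by
        simp only [hu]
        push_cast
        ring_nf
      rw [Finset.sum_range_succ, neg_add, Complex.exp_add, ← mul_assoc, ← ih, hE,
        Complex.exp_add, Complex.exp_add, Complex.exp_log hn, Nat.cast_succ, ← add_assoc,
        Complex.Gamma_add_one _ hn, Complex.exp_neg]
      field_simp
  set c : ℂ := ((√2 * √π : ℝ) : ℂ) with hc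
  set R : ℂ := Complex.Gamma z / Complex.exp (stirlingExponent z) with hRdef
  have hR0 : R ≠ 0 := div_ne_zero hG (Complex.exp_ne_zero _)
  have hlim : Filter.Tendsto (fun n : ℕ => Complex.exp (-∑ j ∈ Finset.range (n + 1), u j))
      Filter.atTop (nhds (c / R)) := by
    refine ((tendsto_Gamma_add_div_exp_stirlingExponent hz).div_const R).congr fun n => ?_
    rw [hR, mul_div_cancel_left₀ _ hR0]
  have hclosed : IsClosed (Complex.exp '' Metric.closedBall 0 (16 / Y)) :=
    ((isCompact_closedBall _ _).image Complex.continuous_exp).isClosed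
  obtain ⟨e, he, hexp⟩ := hclosed.mem_of_tendsto hlim (Filter.Eventually.of_forall fun n =>
    ⟨_, by rw [mem_closedBall_zero_iff, norm_neg]; exact hS (n + 1), rfl⟩)
  refine ⟨-e, by rwa [norm_neg, ← mem_closedBall_zero_iff], ?_⟩
  rw [Complex.exp_add, Complex.exp_neg, hexp, inv_div, mul_left_comm, mul_div_cancel₀, hRdef,
    mul_div_cancel₀ _ (Complex.exp_ne_zero _)]
  rw [hc]
  have : 0 < √2 * √π := by have := Real.pi_pos; positivity
  exact_mod_cast this.ne'

theorem norm_stirlingExponent_add_ofReal_sub_le {z : ℂ} {a : ℝ} (hz : z.im ≠ 0)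
    (h1 : 1 ≤ ‖z‖) (ha : 2 * |a| ≤ ‖z‖) :
    ‖stirlingExponent (z + a) - (stirlingExponent z + a * Complex.log z)‖ ≤
      ((|a| + 1 / 2) * |a| + (3 / 2 + |a|) * |a| ^ 2) / ‖z‖ := by
  have hz0 : z ≠ 0 := fun h => hz (by simp [h])
  have ha0 := abs_nonneg a
  have hlog := log_add_ofReal_eq hz (show |a| < ‖z‖ by linarith)
  have hwn : ‖(a : ℂ) / z‖ = |a| / ‖z‖ := by
    rw [norm_div, Complex.norm_real, Real.norm_eq_abs]
  have hwle : ‖(a : ℂ) / z‖ ≤ 1 / 2 := by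
    rw [hwn, div_le_div_iff₀ (by linarith) (by norm_num)]
    linarith
  have hr := Complex.norm_log_one_add_sub_self_le (z := (a : ℂ) / z) (by linarith)
  set r := Complex.log (1 + a / z) - a / z with hr'
  have hrn : ‖r‖ ≤ (|a| / ‖z‖) ^ 2 := by
    refine hr.trans ?_
    have h2 : (1 - ‖(a : ℂ) / z‖)⁻¹ ≤ 2 := by
      rw [inv_le_comm₀ (by linarith) (by norm_num)]; linarith
    calc ‖(a : ℂ) / z‖ ^ 2 * (1 - ‖(a : ℂ) / z‖)⁻¹ / 2 ≤ ‖(a : ℂ) / z‖ ^ 2 * 2 / 2 := by gcongr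
      _ = (|a| / ‖z‖) ^ 2 := by rw [hwn]; ring
  have key : stirlingExponent (z + a) - (stirlingExponent z + a * Complex.log z) =
      (a - 1 / 2) * (a / z) + (z + (a - 1 / 2)) * r := by
    have htay : Complex.log (1 + a / z) = a / z + r := by rw [hr']; ring
    simp only [stirlingExponent]
    rw [hlog, htay]
    field_simp
    ring
  have hb : ‖(a : ℂ) - 1 / 2‖ ≤ |a| + 1 / 2 := by
    refine (norm_sub_le _ _).trans ?_
    rw [Complex.norm_real, Real.norm_eq_abs]
    norm_num
  have hzpos : 0 < ‖z‖ := by linarith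
  have hb2 : ‖z + ((a : ℂ) - 1 / 2)‖ ≤ (3 / 2 + |a|) * ‖z‖ := by
    refine (norm_add_le _ _).trans ?_
    nlinarith
  rw [key]
  calc ‖((a : ℂ) - 1 / 2) * (a / z) + (z + (a - 1 / 2)) * r‖
      ≤ (|a| + 1 / 2) * (|a| / ‖z‖) + (3 / 2 + |a|) * ‖z‖ * (|a| / ‖z‖) ^ 2 := by
        refine (norm_add_le _ _).trans ?_
        rw [norm_mul, norm_mul, hwn]
        gcongr
    _ = ((|a| + 1 / 2) * |a| + (3 / 2 + |a|) * |a| ^ 2) / ‖z‖ := by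
        field_simp

/-- Stirling's formula for `Γ (k * s + a)`, as `s` varies in a vertical strip. -/
theorem exists_Gamma_mul_add_eq (A B a : ℝ) {k : ℝ} (hk : k ≠ 0) :
    ∃ K T : ℝ, 0 < K ∧ 0 < T ∧ ∀ s : ℂ, A ≤ s.re → s.re ≤ B → T ≤ |s.im| →
      ∃ e : ℂ, ‖e‖ ≤ K / ‖s‖ ∧
        Complex.Gamma (k * s + a) = ((√2 * √π : ℝ) : ℂ) *
          Complex.exp (stirlingExponent (k * s) + a * Complex.log (k * s) + e) := by
  have hk' : 0 < |k| := abs_pos.2 hk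
  set N := |A| + |B| with hN
  have hN0 : 0 ≤ N := by positivity
  set M := |k| * N + |a| with hM
  set D := (|a| + 1 / 2) * |a| + (3 / 2 + |a|) * |a| ^ 2 with hD
  have ha0 := abs_nonneg a
  have hD0 : 0 ≤ D := by positivity
  have hM0 : 0 ≤ M := by positivity
  refine ⟨16 * (N + 1) / |k| + D / |k|, (2 * M + 2) / |k| + 1, by positivity, by positivity,
    fun s hA hB hT => ?_⟩
  have hs1 : 1 ≤ |s.im| := by
    have : 0 ≤ (2 * M + 2) / |k| := by positivity
    linarith
  have hre : |s.re| ≤ N := by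
    rw [abs_le]
    constructor <;>
      linarith [neg_abs_le A, le_abs_self B, abs_nonneg A, abs_nonneg B]
  have hkim : (k * s : ℂ).im = k * s.im := by simp
  have hkre : (k * s : ℂ).re = k * s.re := by simp
  have him : 2 * M + 2 ≤ |k| * |s.im| := by
    have h : (2 * M + 2) / |k| ≤ |s.im| := by linarith
    rwa [div_le_iff₀' hk'] at h
  have hsim : s.im ≠ 0 := fun h => by rw [h, abs_zero] at hs1; norm_num at hs1
  have hnorm : ‖(k * s : ℂ)‖ = |k| * ‖s‖ := by
    rw [norm_mul, Complex.norm_real, Real.norm_eq_abs]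
  have hle : |k| * |s.im| ≤ |k| * ‖s‖ := by gcongr; exact Complex.abs_im_le_norm s
  have hsn : ‖s‖ ≤ (N + 1) * |s.im| := by
    have := Complex.norm_le_abs_re_add_abs_im s
    nlinarith
  have hs0 : 0 < ‖s‖ := by linarith [Complex.abs_im_le_norm s]
  have haM : |a| ≤ M := by rw [hM]; linarith [mul_nonneg hk'.le hN0]
  obtain ⟨e, he, hGamma⟩ := exists_Gamma_eq_exp_stirlingExponent (M := M) (z := k * s + a)
    (by
      rw [Complex.add_re, hkre, Complex.ofReal_re]
      refine (abs_add_le _ _).trans ?_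
      rw [abs_mul, hM]
      gcongr)
    (by rwa [Complex.add_im, hkim, Complex.ofReal_im, add_zero, abs_mul])
  have hshift := norm_stirlingExponent_add_ofReal_sub_le (z := k * s) (a := a)
    (by rw [hkim]; exact mul_ne_zero hk hsim) (by rw [hnorm]; linarith)
    (by rw [hnorm]; linarith)
  refine ⟨e + (stirlingExponent (k * s + a) -
    (stirlingExponent (k * s) + a * Complex.log (k * s))), ?_, ?_⟩
  · rw [add_div]
    refine norm_add_le_of_le (he.trans ?_) (hshift.trans_eq ?_)
    · rw [Complex.add_im, hkim, Complex.ofReal_im, add_zero, abs_mul, div_div,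
        div_le_div_iff₀ (by positivity) (by positivity)]
      nlinarith
    · rw [hnorm, div_div]
  · rw [hGamma]
    congr 2
    ring

/-- On fixed vertical strips, the triple quotient of Gamma factors reduces to a single one. -/
theorem stmt_12 (α β γ A B : ℝ) (hsum : α + β + γ = 0) (hAB : A ≤ B) :
    ∃ C T₀ : ℝ, 0 < C ∧ 0 < T₀ ∧
      ∀ s : ℂ, A ≤ s.re → s.re ≤ B → T₀ ≤ |s.im| →
        ∃ E : ℂ, ‖E‖ ≤ C / ‖s‖ ∧
          Complex.Gamma ((1 - s + α) / 2) * Complex.Gamma ((1 - s + β) / 2) *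
              Complex.Gamma ((1 - s + γ) / 2) /
            (Complex.Gamma ((s - α) / 2) * Complex.Gamma ((s - β) / 2) *
              Complex.Gamma ((s - γ) / 2)) =
            (3 : ℂ) ^ (3 * s - 3 / 2) *
              (Complex.Gamma ((1 - 3 * s) / 2) / Complex.Gamma ((3 * s - 2) / 2)) *
                (1 + E) := by
  have hneg : (-1 / 2 : ℝ) ≠ 0 := by norm_num
  have hpos : (1 / 2 : ℝ) ≠ 0 := by norm_num
  obtain ⟨K₁, T₁, hK₁, hT₁, h₁⟩ := exists_Gamma_mul_add_eq A B ((1 + α) / 2) hneg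
  obtain ⟨K₂, T₂, hK₂, hT₂, h₂⟩ := exists_Gamma_mul_add_eq A B ((1 + β) / 2) hneg
  obtain ⟨K₃, T₃, hK₃, hT₃, h₃⟩ := exists_Gamma_mul_add_eq A B ((1 + γ) / 2) hneg
  obtain ⟨K₄, T₄, hK₄, hT₄, h₄⟩ := exists_Gamma_mul_add_eq A B (-α / 2) hpos
  obtain ⟨K₅, T₅, hK₅, hT₅, h₅⟩ := exists_Gamma_mul_add_eq A B (-β / 2) hpos
  obtain ⟨K₆, T₆, hK₆, hT₆, h₆⟩ := exists_Gamma_mul_add_eq A B (-γ / 2) hpos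
  obtain ⟨K₇, T₇, hK₇, hT₇, h₇⟩ :=
    exists_Gamma_mul_add_eq A B (1 / 2) (show (-3 / 2 : ℝ) ≠ 0 by norm_num)
  obtain ⟨K₈, T₈, hK₈, hT₈, h₈⟩ :=
    exists_Gamma_mul_add_eq A B (-1) (show (3 / 2 : ℝ) ≠ 0 by norm_num)
  set K := K₁ + K₂ + K₃ + K₄ + K₅ + K₆ + K₇ + K₈ with hK
  refine ⟨2 * K, T₁ + T₂ + T₃ + T₄ + T₅ + T₆ + T₇ + T₈ + K, by positivity, by positivity,
    fun s hA hB hT => ?_⟩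
  have hK0 : 0 < K := by positivity
  obtain ⟨e₁, he₁, hG₁⟩ := h₁ s hA hB (by linarith)
  obtain ⟨e₂, he₂, hG₂⟩ := h₂ s hA hB (by linarith)
  obtain ⟨e₃, he₃, hG₃⟩ := h₃ s hA hB (by linarith)
  obtain ⟨e₄, he₄, hG₄⟩ := h₄ s hA hB (by linarith)
  obtain ⟨e₅, he₅, hG₅⟩ := h₅ s hA hB (by linarith)
  obtain ⟨e₆, he₆, hG₆⟩ := h₆ s hA hB (by linarith)
  obtain ⟨e₇, he₇, hG₇⟩ := h₇ s hA hB (by linarith)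
  obtain ⟨e₈, he₈, hG₈⟩ := h₈ s hA hB (by linarith)
  have hKs : K ≤ ‖s‖ := by linarith [Complex.abs_im_le_norm s]
  have hs0 : s ≠ 0 := norm_pos_iff.1 (hK0.trans_le hKs)
  set δ := e₁ + e₂ + e₃ - e₄ - e₅ - e₆ - e₇ + e₈ with hδ
  have hδn : ‖δ‖ ≤ K / ‖s‖ := by
    rw [hδ, hK]
    simp only [add_div]
    exact norm_add_le_of_le (norm_sub_le_of_le (norm_sub_le_of_le (norm_sub_le_of_le
      (norm_sub_le_of_le (norm_add_le_of_le (norm_add_le_of_le he₁ he₂) he₃) he₄) he₅) he₆) he₇) he₈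
  have hδ1 : ‖δ‖ ≤ 1 := hδn.trans ((div_le_one (hK0.trans_le hKs)).2 hKs)
  refine ⟨Complex.exp δ - 1, ?_, ?_⟩
  · refine (Complex.norm_exp_sub_one_le hδ1).trans ?_
    rw [mul_div_assoc]
    gcongr
  have hc : ((√2 * √π : ℝ) : ℂ) ≠ 0 := by
    have : 0 < √2 * √π := by have := Real.pi_pos; positivity
    exact_mod_cast this.ne'
  have hlog : ∀ k : ℝ, k ≠ 0 →
      Complex.log ((3 * k : ℝ) * s) = Complex.log 3 + Complex.log (k * s) := by
    intro k hk
    have h := Complex.log_ofReal_mul (r := 3) (by norm_num)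
      (mul_ne_zero (Complex.ofReal_ne_zero.2 hk) hs0)
    rw [Complex.ofReal_log (by norm_num), ← mul_assoc, ← Complex.ofReal_mul] at h
    simpa using h
  have hl₇ := hlog (-1 / 2) hneg
  have hl₈ := hlog (1 / 2) hpos
  rw [show (3 * (-1 / 2) : ℝ) = -3 / 2 by norm_num] at hl₇
  rw [show (3 * (1 / 2) : ℝ) = 3 / 2 by norm_num] at hl₈
  have hγ : (γ : ℂ) = -α - β := by
    rw [show γ = -α - β by linarith]
    push_cast
    ring
  rw [show (1 - s + α) / 2 = ((-1 / 2 : ℝ) : ℂ) * s + ((1 + α) / 2 : ℝ) by push_cast; ring, hG₁,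
    show (1 - s + β) / 2 = ((-1 / 2 : ℝ) : ℂ) * s + ((1 + β) / 2 : ℝ) by push_cast; ring, hG₂,
    show (1 - s + γ) / 2 = ((-1 / 2 : ℝ) : ℂ) * s + ((1 + γ) / 2 : ℝ) by push_cast; ring, hG₃,
    show (s - α) / 2 = ((1 / 2 : ℝ) : ℂ) * s + (-α / 2 : ℝ) by push_cast; ring, hG₄,
    show (s - β) / 2 = ((1 / 2 : ℝ) : ℂ) * s + (-β / 2 : ℝ) by push_cast; ring, hG₅,
    show (s - γ) / 2 = ((1 / 2 : ℝ) : ℂ) * s + (-γ / 2 : ℝ) by push_cast; ring, hG₆,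
    show (1 - 3 * s) / 2 = ((-3 / 2 : ℝ) : ℂ) * s + (1 / 2 : ℝ) by push_cast; ring, hG₇,
    show (3 * s - 2) / 2 = ((3 / 2 : ℝ) : ℂ) * s + (-1 : ℝ) by push_cast; ring, hG₈,
    Complex.cpow_def_of_ne_zero (by norm_num), add_sub_cancel]
  have hquot₃ : ∀ c x₁ x₂ x₃ y₁ y₂ y₃ : ℂ, c ≠ 0 →
      c * Complex.exp x₁ * (c * Complex.exp x₂) * (c * Complex.exp x₃) /
        (c * Complex.exp y₁ * (c * Complex.exp y₂) * (c * Complex.exp y₃)) =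
      Complex.exp (x₁ + x₂ + x₃ - (y₁ + y₂ + y₃)) := by
    intro c x₁ x₂ x₃ y₁ y₂ y₃ hc
    simp only [Complex.exp_sub, Complex.exp_add]
    field_simp
  rw [hquot₃ _ _ _ _ _ _ _ hc, mul_div_mul_left _ _ hc, ← Complex.exp_sub, ← Complex.exp_add,
    ← Complex.exp_add]
  congr 1
  simp only [stirlingExponent, hl₇, hl₈, hδ]
  push_cast
  rw [hγ]
  ring
end
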